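/- Let 1 < q < ∞, fix k ∈ ℕ, and for each n ≥ k let X̃^{(n)} be uniformly distributed on D̃_{q,1}^n = n^{1/q} B_{q,1}^n. Then the random vector (X̃_1^{(n)},…,X̃_k^{(n)}) converges in distribution, as n → ∞, to a vector of k independent random variables each with Lebesgue density f_{q,1}(x) = (q/2)(1-(q-1)|x|)^{1/(q-1)} 1_{[-1/(q-1), 1/(q-1)]}(x); that is, for every bounded continuous f : ℝ^k → ℝ, E[f(X̃_1^{(n)},…,X̃_k^{(n)})] → ∫_{ℝ^k} f dν_{q,1}^{⊗k}, where ν_{q,1} is the probability measure with density f_{q,1}. -/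

import Mathlib

open MeasureTheory Finset Filter
open scoped ENNReal NNReal

noncomputable section

/-- `sortedAbs x i` is the `i`-th largest value among `|x 0|, …, |x (n-1)|`
(`i = 0` gives the largest), i.e. the non-increasing rearrangement of `|x|`. -/
def sortedAbs {n : ℕ} (x : Fin n → ℝ) (i : Fin n) : ℝ :=
  |x (Tuple.sort (fun j => |x j|) i.rev)|

/-- The Lorentz norm `‖x‖_{q,1} = ∑_{i=1}^n i^{1/q-1} x_i^*` for `1 < q < ∞`. -/
def lorentzNorm (q : ℝ) {n : ℕ} (x : Fin n → ℝ) : ℝ :=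
  ∑ i : Fin n, ((i : ℝ) + 1) ^ (1 / q - 1) * sortedAbs x i

/-- The unit ball of the Lorentz space `ℓ_{q,1}^n`. -/
def lorentzBall (q : ℝ) (n : ℕ) : Set (Fin n → ℝ) :=
  {x | lorentzNorm q x ≤ 1}

/-- The normalized Lorentz ball `D̃_{q,1}^n = n^{1/q} B_{q,1}^n`. -/
def scaledLorentzBall (q : ℝ) (n : ℕ) : Set (Fin n → ℝ) :=
  (fun x => ((n : ℝ) ^ (1 / q)) • x) '' lorentzBall q n

/-- The uniform probability measure on a set (normalized restricted Lebesgue measure). -/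
def unifOn {n : ℕ} (s : Set (Fin n → ℝ)) : Measure (Fin n → ℝ) :=
  (volume s)⁻¹ • volume.restrict s

/-- The limiting density `f_{q,1}(x) = (q/2)(1-(q-1)|x|)^{1/(q-1)}` on
`[-1/(q-1), 1/(q-1)]`, extended by `0` elsewhere. -/
def limitDensity (q : ℝ) : ℝ → ℝ :=
  Set.indicator (Set.Icc (-(1 / (q - 1))) (1 / (q - 1)))
    (fun x => q / 2 * (1 - (q - 1) * |x|) ^ (1 / (q - 1)))

/-- The limiting measure `ν_{q,1}` with density `f_{q,1}`. -/
def limitMeasure (q : ℝ) : Measure ℝ :=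
  volume.withDensity fun x => ENNReal.ofReal (limitDensity q x)

/-! ### The Lorentz norm -/

/-- The partial sums `W_n = ∑_{i=1}^n i^{1/q-1}` of the Lorentz weights. -/
def weightSum (q : ℝ) (n : ℕ) : ℝ :=
  ∑ i ∈ range n, ((i : ℝ) + 1) ^ (1 / q - 1)

lemma sortedAbs_antitone {n : ℕ} (x : Fin n → ℝ) : Antitone (sortedAbs x) := by
  intro i j hij
  exact Tuple.monotone_sort (fun j => |x j|) (Fin.rev_le_rev.mpr hij)

lemma exists_perm_sortedAbs {n : ℕ} (x : Fin n → ℝ) :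
    ∃ σ : Equiv.Perm (Fin n), ∀ i, sortedAbs x i = |x (σ i)| :=
  ⟨Fin.revPerm.trans (Tuple.sort fun j => |x j|), fun _ => rfl⟩

lemma sortedAbs_eq_of_antitone {n : ℕ} {x : Fin n → ℝ} (σ : Equiv.Perm (Fin n))
    (h : Antitone fun i => |x (σ i)|) (i : Fin n) : sortedAbs x i = |x (σ i)| := by
  have h2 : Antitone ((fun j => |x j|) ∘ (Fin.revPerm.trans (Tuple.sort fun j => |x j|))) :=
    sortedAbs_antitone x
  exact congrFun (Tuple.unique_antitone h2 h) i

lemma lorentzNorm_eq_of_antitone (q : ℝ) {n : ℕ} {x : Fin n → ℝ} (σ : Equiv.Perm (Fin n))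
    (h : Antitone fun i => |x (σ i)|) :
    lorentzNorm q x = ∑ i : Fin n, ((i : ℝ) + 1) ^ (1 / q - 1) * |x (σ i)| := by
  simp only [lorentzNorm, sortedAbs_eq_of_antitone σ h]

lemma sortedAbs_comp_perm {n : ℕ} (x : Fin n → ℝ) (τ : Equiv.Perm (Fin n)) :
    sortedAbs (fun i => x (τ i)) = sortedAbs x := by
  obtain ⟨σ, hσ⟩ := exists_perm_sortedAbs (fun i => x (τ i))
  funext i
  have h := sortedAbs_antitone (fun i => x (τ i))
  rw [hσ i, sortedAbs_eq_of_antitone (x := x) (σ.trans τ)]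
  · rfl
  · intro a b hab
    have := h hab
    rwa [hσ a, hσ b] at this

lemma lorentzNorm_comp_perm (q : ℝ) {n : ℕ} (x : Fin n → ℝ) (τ : Equiv.Perm (Fin n)) :
    lorentzNorm q (fun i => x (τ i)) = lorentzNorm q x := by
  simp only [lorentzNorm, sortedAbs_comp_perm]

lemma sortedAbs_congr_abs {n : ℕ} {x y : Fin n → ℝ} (h : ∀ i, |x i| = |y i|) :
    sortedAbs x = sortedAbs y := by
  funext i
  simp only [sortedAbs, h]

lemma lorentzNorm_congr_abs (q : ℝ) {n : ℕ} {x y : Fin n → ℝ} (h : ∀ i, |x i| = |y i|) :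
    lorentzNorm q x = lorentzNorm q y := by
  simp only [lorentzNorm, sortedAbs_congr_abs h]

lemma lorentzNorm_nonneg (q : ℝ) {n : ℕ} (x : Fin n → ℝ) : 0 ≤ lorentzNorm q x :=
  Finset.sum_nonneg fun i _ => mul_nonneg (by positivity) (abs_nonneg _)

lemma lorentzNorm_smul (q : ℝ) {n : ℕ} {a : ℝ} (ha : 0 ≤ a) (x : Fin n → ℝ) :
    lorentzNorm q (a • x) = a * lorentzNorm q x := by
  obtain ⟨σ, hσ⟩ := exists_perm_sortedAbs x
  have h1 : ∀ i, sortedAbs (a • x) i = a * sortedAbs x i := by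
    intro i
    rw [sortedAbs_eq_of_antitone σ, hσ]
    · simp [abs_mul, abs_of_nonneg ha]
    · intro i j hij
      have := mul_le_mul_of_nonneg_left (sortedAbs_antitone x hij) ha
      rw [hσ, hσ] at this
      simpa [abs_mul, abs_of_nonneg ha] using this
  simp only [lorentzNorm, h1, Finset.mul_sum]
  exact Finset.sum_congr rfl fun i _ => by ring

lemma lorentzWeight_antitone {q : ℝ} (hq : 1 < q) {n : ℕ} :
    Antitone fun i : Fin n => ((i : ℝ) + 1) ^ (1 / q - 1) := by
  intro i j hij
  refine Real.rpow_le_rpow_of_nonpos (by positivity) ?_ ?_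
  · have : (i : ℕ) ≤ j := hij
    have : ((i : ℕ) : ℝ) ≤ (j : ℕ) := by exact_mod_cast this
    linarith
  · have : 1 / q ≤ 1 := by rw [div_le_one (by linarith)]; exact hq.le
    linarith

lemma sum_perm_le_lorentzNorm {q : ℝ} (hq : 1 < q) {n : ℕ} (x : Fin n → ℝ)
    (τ : Equiv.Perm (Fin n)) :
    ∑ i : Fin n, ((i : ℝ) + 1) ^ (1 / q - 1) * |x (τ i)| ≤ lorentzNorm q x := by
  obtain ⟨σ, hσ⟩ := exists_perm_sortedAbs x
  have hmono : Monovary (fun i : Fin n => ((i : ℝ) + 1) ^ (1 / q - 1)) (sortedAbs x) :=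
    (lorentzWeight_antitone hq).monovary (sortedAbs_antitone x)
  have := hmono.sum_mul_comp_perm_le_sum_mul (σ := τ.trans σ.symm)
  simpa [lorentzNorm, hσ] using this

lemma continuous_lorentzNorm {q : ℝ} (hq : 1 < q) (n : ℕ) :
    Continuous (lorentzNorm q : (Fin n → ℝ) → ℝ) := by
  have h : (lorentzNorm q : (Fin n → ℝ) → ℝ) = fun x =>
      (univ : Finset (Equiv.Perm (Fin n))).sup' univ_nonempty fun τ =>
        ∑ i : Fin n, ((i : ℝ) + 1) ^ (1 / q - 1) * |x (τ i)| := by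
    funext x
    apply le_antisymm
    · obtain ⟨σ, hσ⟩ := exists_perm_sortedAbs x
      refine le_trans (le_of_eq ?_) (Finset.le_sup' (fun τ : Equiv.Perm (Fin n) =>
        ∑ i : Fin n, ((i : ℝ) + 1) ^ (1 / q - 1) * |x (τ i)|) (mem_univ σ))
      simp [lorentzNorm, hσ]
    · exact Finset.sup'_le _ _ fun τ _ => sum_perm_le_lorentzNorm hq x τ
  rw [h]
  refine Continuous.finset_sup'_apply _ fun τ _ => ?_
  fun_prop

/-- Averages of coordinates are controlled by the Lorentz norm. -/
lemma sum_abs_le_lorentzNorm {q : ℝ} (hq : 1 < q) {n : ℕ} (x : Fin n → ℝ) :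
    (n : ℝ) ^ (1 / q - 1) * ∑ i, |x i| ≤ lorentzNorm q x := by
  refine le_trans ?_ (sum_perm_le_lorentzNorm hq x 1)
  rw [Finset.mul_sum]
  refine Finset.sum_le_sum fun i _ => mul_le_mul_of_nonneg_right ?_ (abs_nonneg _)
  refine Real.rpow_le_rpow_of_nonpos (by positivity) ?_ ?_
  · exact_mod_cast i.2
  · have : 1 / q ≤ 1 := by rw [div_le_one (by linarith)]; exact hq.le
    linarith

/-- Splitting off the smallest coordinate. -/
lemma lorentzNorm_insertNth (q : ℝ) {n : ℕ} (j : Fin (n + 1)) {m : ℝ} (hm : 0 ≤ m)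
    {z : Fin n → ℝ} (hz : ∀ i, 0 ≤ z i) :
    lorentzNorm q (j.insertNth m (fun i => m + z i) : Fin (n + 1) → ℝ)
      = weightSum q (n + 1) * m + lorentzNorm q z := by
  obtain ⟨σ, hσ⟩ := exists_perm_sortedAbs z
  have hanti : ∀ a b : Fin n, a ≤ b → z (σ b) ≤ z (σ a) := by
    intro a b hab
    have := sortedAbs_antitone z hab
    rwa [hσ, hσ, abs_of_nonneg (hz _), abs_of_nonneg (hz _)] at this
  set x : Fin (n + 1) → ℝ := j.insertNth m (fun i => m + z i) with hx
  let f : Fin (n + 1) → Fin (n + 1) := Fin.snoc (fun i => j.succAbove (σ i)) j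
  have hf : Function.Injective f := by
    intro a b
    refine Fin.lastCases ?_ (fun a => ?_) a <;> refine Fin.lastCases ?_ (fun b => ?_) b
    · simp
    · simp [f, Fin.snoc_castSucc, eq_comm]
    · simp [f, Fin.snoc_castSucc]
    · simp [f, Fin.snoc_castSucc]
  let τ : Equiv.Perm (Fin (n + 1)) := Equiv.ofBijective f (Finite.injective_iff_bijective.mp hf)
  have h1 : ∀ i : Fin n, |x (τ i.castSucc)| = m + z (σ i) := fun i => by
    simp [τ, f, hx, abs_of_nonneg (add_nonneg hm (hz _))]
  have h2 : |x (τ (Fin.last n))| = m := by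
    simp [τ, f, hx, abs_of_nonneg hm]
  rw [lorentzNorm_eq_of_antitone q τ, Fin.sum_univ_castSucc]
  · simp only [h1, h2, weightSum, Finset.sum_range_succ, lorentzNorm, hσ, abs_of_nonneg (hz _),
      mul_add, Finset.sum_add_distrib, add_mul, Fin.val_castSucc, Fin.val_last]
    rw [← Finset.sum_mul, Finset.sum_range]
    ring
  · intro a b
    refine Fin.lastCases ?_ (fun a => ?_) a <;> refine Fin.lastCases ?_ (fun b => ?_) b
    · simp
    · intro h
      exact absurd h (by simp)
    · intro _
      change |x (τ (Fin.last n))| ≤ |x (τ a.castSucc)|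
      rw [h1, h2]
      linarith [hz (σ a)]
    · intro h
      change |x (τ b.castSucc)| ≤ |x (τ a.castSucc)|
      rw [h1, h1]
      linarith [hanti a b (by simpa using h)]

lemma weightSum_pos (q : ℝ) (n : ℕ) : 0 < weightSum q (n + 1) :=
  Finset.sum_pos (fun i _ => by positivity) (by simp)

lemma one_le_weightSum (q : ℝ) (n : ℕ) : 1 ≤ weightSum q (n + 1) := by
  rw [weightSum, Finset.sum_range_succ']
  have : 0 ≤ ∑ i ∈ range n, (((i + 1 : ℕ) : ℝ) + 1) ^ (1 / q - 1) :=
    Finset.sum_nonneg fun i _ => by positivity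
  simpa using this

/-! ### Peeling off the smallest coordinate -/

/-- Lebesgue measure on the open positive orthant. -/
def orthantMeasure (n : ℕ) : Measure (Fin n → ℝ) :=
  Measure.pi fun _ => volume.restrict (Set.Ioi 0)

instance (n : ℕ) : SigmaFinite (orthantMeasure n) := by
  unfold orthantMeasure; infer_instance

lemma orthantMeasure_eq_restrict (n : ℕ) :
    orthantMeasure n = volume.restrict (Set.univ.pi fun _ => Set.Ioi 0) :=
  (Measure.restrict_pi_pi (fun _ : Fin n => (volume : Measure ℝ)) fun _ => Set.Ioi 0).symm

lemma ae_orthantMeasure_pos (n : ℕ) : ∀ᵐ x ∂orthantMeasure n, ∀ i, 0 < x i := by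
  rw [orthantMeasure_eq_restrict]
  filter_upwards [ae_restrict_mem (MeasurableSet.univ_pi fun _ => measurableSet_Ioi)] with x hx i
  exact hx i (Set.mem_univ i)

lemma ae_orthantMeasure_injective (n : ℕ) :
    ∀ᵐ x ∂orthantMeasure n, Function.Injective x := by
  rw [orthantMeasure_eq_restrict]
  refine ae_restrict_of_ae ?_
  have h : ∀ i j : Fin n, ∀ᵐ x : Fin n → ℝ, x i = x j → i = j := by
    intro i j
    by_cases hij : i = j
    · simp [hij]
    let L : (Fin n → ℝ) →ₗ[ℝ] ℝ :=
      LinearMap.proj (R := ℝ) (φ := fun _ : Fin n => ℝ) i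
        - LinearMap.proj (R := ℝ) (φ := fun _ : Fin n => ℝ) j
    have hL : ∀ x, L x = x i - x j := fun _ => rfl
    have h0 := Measure.addHaar_submodule (volume : Measure (Fin n → ℝ)) (LinearMap.ker L) (by
        intro htop
        have hmem : (Pi.single i 1 : Fin n → ℝ) ∈ LinearMap.ker L := by
          rw [htop]; trivial
        simp [LinearMap.mem_ker, hL, Ne.symm hij] at hmem)
    rw [ae_iff]
    refine measure_mono_null ?_ h0
    intro x hx
    have : x i = x j := by
      by_contra hne
      exact hx fun h => absurd h hne
    simp [LinearMap.mem_ker, hL, this]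
  filter_upwards [ae_all_iff.mpr fun i => ae_all_iff.mpr (h i)] with x hx i j
  exact hx i j

lemma orthantMeasure_restrict_Ioi {n : ℕ} {m : ℝ} (hm : 0 < m) :
    (orthantMeasure n).restrict (Set.univ.pi fun _ => Set.Ioi m)
      = (orthantMeasure n).map fun z i => m + z i := by
  have h1 : (volume.restrict (Set.Ioi (0 : ℝ))).restrict (Set.Ioi m)
      = (volume.restrict (Set.Ioi (0 : ℝ))).map (fun t => m + t) := by
    rw [Measure.restrict_restrict measurableSet_Ioi]
    have h2 : (fun t : ℝ => m + t) ⁻¹' Set.Ioi m = Set.Ioi 0 := by ext; simp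
    rw [← h2, ← Measure.restrict_map (measurable_const_add m) measurableSet_Ioi,
      map_add_left_eq_self, h2,
      Set.inter_eq_left.mpr (Set.Ioi_subset_Ioi hm.le)]
  rw [orthantMeasure, Measure.restrict_pi_pi]
  simp_rw [h1]
  have : SigmaFinite ((volume.restrict (Set.Ioi (0 : ℝ))).map (fun t => m + t)) := by
    rw [← h1]; infer_instance
  exact (Measure.pi_map_pi (μ := fun _ : Fin n => volume.restrict (Set.Ioi (0 : ℝ)))
    (f := fun _ t => m + t) fun _ => (measurable_const_add m).aemeasurable).symm

lemma measurable_insertNth {n : ℕ} (j : Fin (n + 1)) :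
    Measurable fun p : ℝ × (Fin n → ℝ) => (j.insertNth p.1 p.2 : Fin (n + 1) → ℝ) :=
  (MeasurableEquiv.piFinSuccAbove (fun _ => ℝ) j).symm.measurable

lemma measurable_insertNth_add {n : ℕ} (j : Fin (n + 1)) :
    Measurable fun p : ℝ × (Fin n → ℝ) =>
      (j.insertNth p.1 (fun i => p.1 + p.2 i) : Fin (n + 1) → ℝ) :=
  (measurable_insertNth j).comp (f := fun p : ℝ × (Fin n → ℝ) => (p.1, fun i => p.1 + p.2 i))
    (by fun_prop)

lemma lintegral_orthantMeasure_argmin {n : ℕ} (j : Fin (n + 1)) {g : (Fin (n + 1) → ℝ) → ℝ≥0∞}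
    (hg : Measurable g) :
    ∫⁻ x, (Set.indicator {x | ∀ i, i ≠ j → x j < x i} g) x ∂orthantMeasure (n + 1)
      = ∫⁻ m in Set.Ioi 0, ∫⁻ z, g (j.insertNth m fun i => m + z i) ∂orthantMeasure n := by
  have hA : MeasurableSet {x : Fin (n + 1) → ℝ | ∀ i, i ≠ j → x j < x i} := by
    have : {x : Fin (n + 1) → ℝ | ∀ i, i ≠ j → x j < x i}
        = ⋂ i, ⋂ (_ : i ≠ j), {x | x j < x i} := by ext; simp
    rw [this]
    exact MeasurableSet.iInter fun i => MeasurableSet.iInter fun _ =>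
      measurableSet_lt (measurable_pi_apply j) (measurable_pi_apply i)
  have hmp := measurePreserving_piFinSuccAbove
    (fun _ : Fin (n + 1) => volume.restrict (Set.Ioi (0 : ℝ))) j
  have hmp' := hmp.symm
  rw [orthantMeasure, ← hmp'.lintegral_comp (hg.indicator hA)]
  refine (lintegral_prod _ ((hg.indicator hA).comp (measurable_insertNth j)).aemeasurable).trans ?_
  refine setLIntegral_congr_fun measurableSet_Ioi fun m hm => ?_
  have hm : 0 < m := hm
  have hS : MeasurableSet (Set.univ.pi fun _ : Fin n => Set.Ioi m) :=
    MeasurableSet.univ_pi fun _ => measurableSet_Ioi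
  have hg' : Measurable fun z : Fin n → ℝ => g (j.insertNth m z) :=
    hg.comp ((measurable_insertNth j).comp (by fun_prop : Measurable fun z => (m, z)))
  calc _ = ∫⁻ z, (Set.univ.pi fun _ : Fin n => Set.Ioi m).indicator
            (fun z => g (j.insertNth m z)) z ∂orthantMeasure n := by
        refine lintegral_congr fun z => ?_
        rw [Function.comp_apply]
        by_cases h : ∀ i, m < z i
        · rw [Set.indicator_of_mem, Set.indicator_of_mem]
          · exact fun i _ => h i
          · intro i hi
            obtain ⟨i, rfl⟩ := Fin.exists_succAbove_eq hi
            simpa using h i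
        · rw [Set.indicator_of_notMem, Set.indicator_of_notMem]
          · exact fun h' => h fun i => h' i (Set.mem_univ i)
          · intro h'
            refine h fun i => ?_
            simpa using h' (j.succAbove i) (Fin.succAbove_ne j i)
    _ = ∫⁻ z, g (j.insertNth m z) ∂(orthantMeasure n).map fun z i => m + z i := by
        rw [lintegral_indicator hS, orthantMeasure_restrict_Ioi hm]
    _ = _ := by
        rw [lintegral_map hg' (by fun_prop)]

lemma lintegral_orthantMeasure_succ {n : ℕ} {g : (Fin (n + 1) → ℝ) → ℝ≥0∞} (hg : Measurable g) :
    ∫⁻ x, g x ∂orthantMeasure (n + 1)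
      = ∑ j : Fin (n + 1), ∫⁻ m in Set.Ioi 0,
          ∫⁻ z, g (j.insertNth m fun i => m + z i) ∂orthantMeasure n := by
  have hA : ∀ j : Fin (n + 1), MeasurableSet {x : Fin (n + 1) → ℝ | ∀ i, i ≠ j → x j < x i} := by
    intro j
    have : {x : Fin (n + 1) → ℝ | ∀ i, i ≠ j → x j < x i}
        = ⋂ i, ⋂ (_ : i ≠ j), {x | x j < x i} := by ext; simp
    rw [this]
    exact MeasurableSet.iInter fun i => MeasurableSet.iInter fun _ =>
      measurableSet_lt (measurable_pi_apply j) (measurable_pi_apply i)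
  simp_rw [← lintegral_orthantMeasure_argmin _ hg]
  rw [← lintegral_finsetSum _ fun j _ => hg.indicator (hA j)]
  refine lintegral_congr_ae ?_
  filter_upwards [ae_orthantMeasure_injective (n + 1)] with x hx
  obtain ⟨j, -, hj⟩ := Finset.exists_min_image univ x univ_nonempty
  rw [Finset.sum_eq_single j]
  · rw [Set.indicator_of_mem]
    exact fun i hi => lt_of_le_of_ne (hj i (mem_univ i)) fun h => hi (hx h).symm
  · intro i _ hij
    rw [Set.indicator_of_notMem]
    intro h
    exact absurd (h j hij.symm) (not_lt.mpr (hj i (mem_univ i)))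
  · simp

/-- The law obtained by successively adding a new smallest coordinate in a uniformly chosen
position, the increments being independent with laws `ρ n`. -/
def peeledMeasure (ρ : ℕ → Measure ℝ) : (n : ℕ) → Measure (Fin n → ℝ)
  | 0 => Measure.dirac 0
  | n + 1 => ((n + 1 : ℕ) : ℝ≥0∞)⁻¹ • ∑ j : Fin (n + 1),
      Measure.map (fun p : ℝ × (Fin n → ℝ) => j.insertNth p.1 fun i => p.1 + p.2 i)
        ((ρ n).prod (peeledMeasure ρ n))

instance (ρ : ℕ → Measure ℝ) [∀ n, IsProbabilityMeasure (ρ n)] (n : ℕ) :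
    IsProbabilityMeasure (peeledMeasure ρ n) := by
  induction n with
  | zero => unfold peeledMeasure; infer_instance
  | succ n ih =>
    refine ⟨?_⟩
    have h1 : ∀ j : Fin (n + 1), Measure.map (fun p : ℝ × (Fin n → ℝ) =>
        (j.insertNth p.1 fun i => p.1 + p.2 i : Fin (n + 1) → ℝ))
        ((ρ n).prod (peeledMeasure ρ n)) Set.univ = 1 := by
      intro j
      rw [Measure.map_apply (measurable_insertNth_add j) MeasurableSet.univ, Set.preimage_univ,
        measure_univ]
    rw [peeledMeasure, Measure.smul_apply, Measure.finsetSum_apply]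
    simp only [h1, sum_const, card_univ, Fintype.card_fin, nsmul_eq_mul, mul_one, smul_eq_mul]
    exact ENNReal.inv_mul_cancel (by simp) (ENNReal.natCast_ne_top _)

lemma lintegral_gammaMeasure {a r : ℝ} {g : ℝ → ℝ≥0∞} (hg : Measurable g) :
    ∫⁻ x, g x ∂ProbabilityTheory.gammaMeasure a r
      = ∫⁻ x in Set.Ioi 0, ENNReal.ofReal
          (r ^ a / Real.Gamma a * x ^ (a - 1) * Real.exp (-(r * x))) * g x := by
  have hm : Measurable (ProbabilityTheory.gammaPDF a r) :=
    (ProbabilityTheory.measurable_gammaPDFReal a r).ennreal_ofReal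
  rw [ProbabilityTheory.gammaMeasure, lintegral_withDensity_eq_lintegral_mul _ hm hg,
    ← setLIntegral_congr (Ioi_ae_eq_Ici (a := (0 : ℝ))).symm,
    ← lintegral_indicator measurableSet_Ici]
  refine lintegral_congr fun x => ?_
  by_cases hx : 0 ≤ x
  · rw [Set.indicator_of_mem (by exact hx), Pi.mul_apply,
      ProbabilityTheory.gammaPDF_of_nonneg hx]
  · rw [Set.indicator_of_notMem (by exact hx), Pi.mul_apply,
      ProbabilityTheory.gammaPDF_of_neg (not_le.mp hx), zero_mul]

lemma lintegral_expMeasure {r : ℝ} {g : ℝ → ℝ≥0∞} (hg : Measurable g) :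
    ∫⁻ x, g x ∂ProbabilityTheory.expMeasure r
      = ENNReal.ofReal r * ∫⁻ x in Set.Ioi 0, ENNReal.ofReal (Real.exp (-(r * x))) * g x := by
  rw [ProbabilityTheory.expMeasure, lintegral_gammaMeasure hg,
    ← lintegral_const_mul' _ _ ENNReal.ofReal_ne_top]
  refine lintegral_congr fun x => ?_
  rw [← mul_assoc, ENNReal.ofReal_mul' (Real.exp_nonneg _)]
  simp

lemma lintegral_peeledMeasure_succ (ρ : ℕ → Measure ℝ) [∀ n, IsProbabilityMeasure (ρ n)] {n : ℕ}
    {g : (Fin (n + 1) → ℝ) → ℝ≥0∞} (hg : Measurable g) :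
    ∫⁻ x, g x ∂peeledMeasure ρ (n + 1) = ((n + 1 : ℕ) : ℝ≥0∞)⁻¹ * ∑ j : Fin (n + 1),
      ∫⁻ m, ∫⁻ z, g (j.insertNth m fun i => m + z i) ∂peeledMeasure ρ n ∂ρ n := by
  rw [peeledMeasure, lintegral_smul_measure, lintegral_finsetSum_measure, smul_eq_mul]
  congr 1
  refine Finset.sum_congr rfl fun j _ => ?_
  rw [lintegral_map hg (measurable_insertNth_add j)]
  exact lintegral_prod _ (hg.comp (measurable_insertNth_add j)).aemeasurable

/-- The density proportional to `exp (-c ‖x‖)` on the orthant describes a peeled measure. -/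
lemma exists_lintegral_exp_lorentzNorm {q : ℝ} (hq : 1 < q) {c : ℝ} (hc : 0 < c) (n : ℕ) :
    ∃ Z : ℝ≥0∞, ∀ g : (Fin n → ℝ) → ℝ≥0∞, Measurable g →
      ∫⁻ x, ENNReal.ofReal (Real.exp (-(c * lorentzNorm q x))) * g x ∂orthantMeasure n
        = Z * ∫⁻ x, g x ∂peeledMeasure
            (fun m => ProbabilityTheory.expMeasure (c * weightSum q (m + 1))) n := by
  have hr : ∀ m, 0 < c * weightSum q (m + 1) := fun m => mul_pos hc (weightSum_pos q m)
  have hP : ∀ m, IsProbabilityMeasure (ProbabilityTheory.expMeasure (c * weightSum q (m + 1))) :=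
    fun m => ProbabilityTheory.isProbabilityMeasure_expMeasure (hr m)
  induction n with
  | zero =>
    refine ⟨1, fun g hg => ?_⟩
    rw [orthantMeasure, Measure.pi_of_empty, peeledMeasure]
    rw [lintegral_dirac, lintegral_dirac]
    simp only [lorentzNorm, univ_eq_empty, sum_empty, mul_zero, neg_zero, Real.exp_zero,
      ENNReal.ofReal_one, one_mul]
    exact congrArg g (Subsingleton.elim _ _)
  | succ n ih =>
    obtain ⟨Z, hZ⟩ := ih
    set r : ℕ → ℝ := fun m => c * weightSum q (m + 1) with hrdef
    set ρ : ℕ → Measure ℝ := fun m => ProbabilityTheory.expMeasure (r m) with hρdef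
    refine ⟨Z * (ENNReal.ofReal (r n))⁻¹ * ((n + 1 : ℕ) : ℝ≥0∞), fun g hg => ?_⟩
    have hmeas : ∀ k, Measurable fun x : Fin k → ℝ =>
        ENNReal.ofReal (Real.exp (-(c * lorentzNorm q x))) := fun k => by
      have := (continuous_lorentzNorm hq k).measurable
      fun_prop
    rw [lintegral_orthantMeasure_succ (g := fun x => _ * g x) ((hmeas _).mul hg),
      lintegral_peeledMeasure_succ ρ hg]
    have hmeas_int : ∀ j : Fin (n + 1), Measurable fun m : ℝ =>
        ∫⁻ z, g (j.insertNth m fun i => m + z i) ∂peeledMeasure ρ n := fun j =>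
      Measurable.lintegral_prod_right' (ν := peeledMeasure ρ n)
        (hg.comp (measurable_insertNth_add j))
    have key : ∀ j : Fin (n + 1), ∫⁻ m in Set.Ioi 0, ∫⁻ z,
        ENNReal.ofReal (Real.exp (-(c * lorentzNorm q
          (j.insertNth m (fun i => m + z i) : Fin (n + 1) → ℝ)))) *
        g (j.insertNth m fun i => m + z i) ∂orthantMeasure n
        = Z * ∫⁻ m in Set.Ioi 0, ENNReal.ofReal (Real.exp (-(r n * m))) *
          ∫⁻ z, g (j.insertNth m fun i => m + z i) ∂peeledMeasure ρ n := by
      intro j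
      have hgj := hg.comp (measurable_insertNth_add j)
      have hexp : Measurable fun m : ℝ => ENNReal.ofReal (Real.exp (-(r n * m))) := by fun_prop
      refine Eq.trans ?_ (lintegral_const_mul Z (hexp.mul (hmeas_int j)))
      refine setLIntegral_congr_fun measurableSet_Ioi fun m hm => ?_
      have hm : 0 < m := hm
      have hgm : Measurable fun z : Fin n → ℝ => g (j.insertNth m fun i => m + z i) :=
        hgj.comp (by fun_prop : Measurable fun z : Fin n → ℝ => (m, z))
      rw [mul_left_comm, ← hZ _ hgm]
      refine Eq.trans ?_ (lintegral_const_mul _ ((hmeas n).mul hgm))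
      refine lintegral_congr_ae ?_
      filter_upwards [ae_orthantMeasure_pos n] with z hz
      rw [lorentzNorm_insertNth q j hm.le fun i => (hz i).le, ← mul_assoc,
        ← ENNReal.ofReal_mul (Real.exp_nonneg _), ← Real.exp_add]
      congr 4
      simp only [hrdef]
      ring
    have hexpj : ∀ j : Fin (n + 1),
        ∫⁻ m, ∫⁻ z, g (j.insertNth m fun i => m + z i) ∂peeledMeasure ρ n ∂ρ n
          = ENNReal.ofReal (r n) * ∫⁻ m in Set.Ioi 0, ENNReal.ofReal (Real.exp (-(r n * m))) *
            ∫⁻ z, g (j.insertNth m fun i => m + z i) ∂peeledMeasure ρ n :=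
      fun j => lintegral_expMeasure (hmeas_int j)
    simp only [key, hexpj, ← Finset.mul_sum]
    have h1 : ENNReal.ofReal (r n) ≠ 0 := by simpa using hr n
    rw [mul_assoc Z, mul_assoc Z, ← mul_assoc (_ * _) (_⁻¹), mul_assoc (_⁻¹) _ (_⁻¹),
      ENNReal.mul_inv_cancel (by simp) (ENNReal.natCast_ne_top _), mul_one, ← mul_assoc (_⁻¹),
      ENNReal.inv_mul_cancel h1 ENNReal.ofReal_ne_top, one_mul]

/-! ### Characters of peeled measures -/

/-- The character `x ↦ exp (i ∑ t_i x_i)`. -/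
def piChar {n : ℕ} (t x : Fin n → ℝ) : ℂ :=
  Complex.exp (((∑ i, t i * x i : ℝ) : ℂ) * Complex.I)

lemma continuous_piChar {n : ℕ} (t : Fin n → ℝ) : Continuous (piChar t) := by
  unfold piChar
  fun_prop

lemma norm_piChar {n : ℕ} (t x : Fin n → ℝ) : ‖piChar t x‖ = 1 :=
  Complex.norm_exp_ofReal_mul_I _

lemma integrable_piChar {n : ℕ} (μ : Measure (Fin n → ℝ)) [IsFiniteMeasure μ] (t : Fin n → ℝ) :
    Integrable (piChar t) μ :=
  Integrable.of_bound (continuous_piChar t).aestronglyMeasurable 1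
    (ae_of_all _ fun x => (norm_piChar t x).le)

lemma norm_integral_piChar_le {n : ℕ} (μ : Measure (Fin n → ℝ)) [IsProbabilityMeasure μ]
    (t : Fin n → ℝ) : ‖∫ x, piChar t x ∂μ‖ ≤ 1 := by
  simpa using norm_integral_le_of_norm_le_const (μ := μ) (ae_of_all _ fun x => (norm_piChar t x).le)

lemma piChar_insertNth {n : ℕ} (t : Fin (n + 1) → ℝ) (j : Fin (n + 1)) (m : ℝ) (z : Fin n → ℝ) :
    piChar t (j.insertNth m fun i => m + z i)
      = Complex.exp ((∑ i, t i : ℝ) * m * Complex.I) * piChar (fun i => t (j.succAbove i)) z := by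
  rw [piChar, piChar, ← Complex.exp_add, ← add_mul, ← Complex.ofReal_mul, ← Complex.ofReal_add]
  congr 3
  rw [Fin.sum_univ_succAbove _ j, Fin.sum_univ_succAbove _ j, add_mul, Finset.sum_mul, add_assoc,
    ← Finset.sum_add_distrib]
  simp [mul_add]

lemma integral_piChar_peeledMeasure_succ (ρ : ℕ → Measure ℝ) [∀ n, IsProbabilityMeasure (ρ n)]
    {n : ℕ} (t : Fin (n + 1) → ℝ) :
    ∫ x, piChar t x ∂peeledMeasure ρ (n + 1)
      = ((n : ℂ) + 1)⁻¹ * ∑ j : Fin (n + 1), charFun (ρ n) (∑ i, t i) *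
          ∫ z, piChar (fun i => t (j.succAbove i)) z ∂peeledMeasure ρ n := by
  have hmap : ∀ j : Fin (n + 1), IsProbabilityMeasure
      (Measure.map (fun p : ℝ × (Fin n → ℝ) =>
        (j.insertNth p.1 fun i => p.1 + p.2 i : Fin (n + 1) → ℝ))
        ((ρ n).prod (peeledMeasure ρ n))) :=
    fun j => Measure.isProbabilityMeasure_map (measurable_insertNth_add j).aemeasurable
  rw [peeledMeasure, integral_smul_measure,
    integral_finsetSum_measure fun j _ => integrable_piChar _ t]
  have h : ((n + 1 : ℕ) : ℝ≥0∞)⁻¹.toReal = ((n : ℝ) + 1)⁻¹ := by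
    rw [ENNReal.toReal_inv, ENNReal.toReal_natCast]
    push_cast
    rfl
  rw [h, Complex.real_smul]
  push_cast
  congr 1
  refine Finset.sum_congr rfl fun j _ => ?_
  rw [integral_map (measurable_insertNth_add j).aemeasurable
    (continuous_piChar t).aestronglyMeasurable]
  simp_rw [piChar_insertNth, charFun_apply_real]
  exact integral_prod_mul (L := ℂ) (fun m : ℝ => Complex.exp ((∑ i, t i : ℝ) * m * Complex.I))
    (piChar fun i => t (j.succAbove i))

/-- Comparison of characters of two peeled measures. -/
lemma norm_integral_piChar_peeledMeasure_sub_le (ρ ρ' : ℕ → Measure ℝ)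
    [∀ n, IsProbabilityMeasure (ρ n)] [∀ n, IsProbabilityMeasure (ρ' n)] {T : ℝ} {δ : ℕ → ℝ}
    (hδ : ∀ m s, |s| ≤ T → ‖charFun (ρ m) s - charFun (ρ' m) s‖ ≤ δ m) (n : ℕ) (t : Fin n → ℝ)
    (ht : ∑ i, |t i| ≤ T) :
    ‖∫ x, piChar t x ∂peeledMeasure ρ n - ∫ x, piChar t x ∂peeledMeasure ρ' n‖
      ≤ ∑ m ∈ range n, δ m := by
  induction n with
  | zero => simp [peeledMeasure]
  | succ n ih =>
    rw [integral_piChar_peeledMeasure_succ, integral_piChar_peeledMeasure_succ, ← mul_sub,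
      ← Finset.sum_sub_distrib, norm_mul]
    have hj : ∀ j : Fin (n + 1),
        ‖charFun (ρ n) (∑ i, t i) * ∫ z, piChar (fun i => t (j.succAbove i)) z ∂peeledMeasure ρ n
          - charFun (ρ' n) (∑ i, t i) *
            ∫ z, piChar (fun i => t (j.succAbove i)) z ∂peeledMeasure ρ' n‖
          ≤ ∑ m ∈ range (n + 1), δ m := by
      intro j
      have htj : ∑ i, |t (j.succAbove i)| ≤ T := by
        rw [Fin.sum_univ_succAbove _ j] at ht
        linarith [abs_nonneg (t j)]
      have h1 := hδ n (∑ i, t i) ((Finset.abs_sum_le_sum_abs _ _).trans ht)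
      have h2 := ih _ htj
      rw [Finset.sum_range_succ]
      have h3 : ‖charFun (ρ' n) (∑ i, t i)‖ ≤ 1 := norm_charFun_le_one _
      have h4 := norm_integral_piChar_le (peeledMeasure ρ n) fun i => t (j.succAbove i)
      generalize ∫ z, piChar (fun i => t (j.succAbove i)) z ∂peeledMeasure ρ n = b at *
      generalize ∫ z, piChar (fun i => t (j.succAbove i)) z ∂peeledMeasure ρ' n = b' at *
      generalize charFun (ρ n) (∑ i, t i) = a at *
      generalize charFun (ρ' n) (∑ i, t i) = a' at *
      calc ‖a * b - a' * b'‖ = ‖a' * (b - b') + (a - a') * b‖ := by ring_nf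
        _ ≤ ‖a'‖ * ‖b - b'‖ + ‖a - a'‖ * ‖b‖ := by
          rw [← norm_mul, ← norm_mul]; exact norm_add_le _ _
        _ ≤ 1 * ‖b - b'‖ + ‖a - a'‖ * 1 := by gcongr
        _ ≤ _ := by linarith
    have hn : ‖((n : ℂ) + 1)⁻¹‖ = ((n : ℝ) + 1)⁻¹ := by
      rw [norm_inv]
      congr 1
      exact_mod_cast Complex.norm_natCast (n + 1)
    have hsum := (norm_sum_le univ _).trans (Finset.sum_le_sum fun j (_ : j ∈ univ) => hj j)
    rw [sum_const, card_univ, Fintype.card_fin, nsmul_eq_mul] at hsum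
    rw [hn, inv_mul_le_iff₀ (by positivity)]
    exact_mod_cast hsum

lemma charFun_dirac_real (a s : ℝ) :
    charFun (Measure.dirac a) s = Complex.exp (s * a * Complex.I) := by
  rw [charFun_apply_real, integral_dirac]

lemma norm_exp_mul_I_sub_one_sub_le (y : ℝ) :
    ‖Complex.exp (y * Complex.I) - 1 - y * Complex.I‖ ≤ 3 * y ^ 2 := by
  have hy : ‖(y : ℂ) * Complex.I‖ = |y| := by simp
  by_cases h : |y| ≤ 1
  · have := Complex.norm_exp_sub_one_sub_id_le (x := (y : ℂ) * Complex.I) (by rwa [hy])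
    rw [hy, sq_abs] at this
    nlinarith [sq_nonneg y]
  · push Not at h
    have h1 : ‖Complex.exp (y * Complex.I) - 1 - y * Complex.I‖ ≤ 1 + 1 + |y| := by
      refine (norm_sub_le _ _).trans ?_
      rw [hy]
      gcongr
      refine (norm_sub_le _ _).trans ?_
      simp [Complex.norm_exp_ofReal_mul_I]
    have : 1 + 1 + |y| ≤ 3 * y ^ 2 := by
      rw [← sq_abs]; nlinarith
    linarith

/-! ### Moments of gamma measures -/

lemma lintegral_ofReal_mul_gammaMeasure {a r : ℝ} (ha : 0 < a) (hr : 0 < r) {g : ℝ → ℝ≥0∞}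
    (hg : Measurable g) :
    ∫⁻ x, ENNReal.ofReal x * g x ∂ProbabilityTheory.gammaMeasure a r
      = ENNReal.ofReal (a / r) * ∫⁻ x, g x ∂ProbabilityTheory.gammaMeasure (a + 1) r := by
  rw [lintegral_gammaMeasure (g := fun x => _ * g x) (by fun_prop), lintegral_gammaMeasure hg,
    ← lintegral_const_mul' _ _ ENNReal.ofReal_ne_top]
  refine setLIntegral_congr_fun measurableSet_Ioi fun x hx => ?_
  have hx : 0 < x := hx
  have hΓ := Real.Gamma_pos_of_pos ha
  rw [← mul_assoc, ← mul_assoc, ← ENNReal.ofReal_mul (by positivity),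
    ← ENNReal.ofReal_mul (by positivity)]
  congr 2
  rw [Real.Gamma_add_one ha.ne', Real.rpow_add_one hr.ne', add_sub_cancel_right,
    Real.rpow_sub_one hx.ne']
  field_simp

lemma ae_gammaMeasure_pos (a r : ℝ) : ∀ᵐ x ∂ProbabilityTheory.gammaMeasure a r, 0 < x := by
  rw [ae_iff]
  have h := lintegral_gammaMeasure (a := a) (r := r)
    (g := Set.indicator {x | ¬ 0 < x} 1) (measurable_one.indicator (by measurability))
  rw [lintegral_indicator_one (by measurability)] at h
  rw [h, setLIntegral_congr_fun (g := fun _ => 0) measurableSet_Ioi]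
  · simp
  · intro x hx
    have hx : 0 < x := hx
    simp [hx]

lemma lintegral_ofReal_gammaMeasure {a r : ℝ} (ha : 0 < a) (hr : 0 < r) :
    ∫⁻ x, ENNReal.ofReal x ∂ProbabilityTheory.gammaMeasure a r = ENNReal.ofReal (a / r) := by
  have := ProbabilityTheory.isProbabilityMeasure_gammaMeasure (a := a + 1) (by linarith) hr
  simpa using lintegral_ofReal_mul_gammaMeasure ha hr (g := fun _ => 1) measurable_const

lemma lintegral_ofReal_sq_gammaMeasure {a r : ℝ} (ha : 0 < a) (hr : 0 < r) :
    ∫⁻ x, ENNReal.ofReal (x ^ 2) ∂ProbabilityTheory.gammaMeasure a r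
      = ENNReal.ofReal (a * (a + 1) / r ^ 2) := by
  have h := lintegral_ofReal_mul_gammaMeasure ha hr (g := fun x => ENNReal.ofReal x)
    ENNReal.measurable_ofReal
  rw [lintegral_ofReal_gammaMeasure (by linarith) hr, ← ENNReal.ofReal_mul (by positivity)] at h
  rw [show a * (a + 1) / r ^ 2 = a / r * ((a + 1) / r) by field_simp, ← h]
  refine lintegral_congr_ae ?_
  filter_upwards [ae_gammaMeasure_pos a r] with x hx
  rw [pow_two, ENNReal.ofReal_mul hx.le]

lemma integrable_sq_gammaMeasure {a r : ℝ} (ha : 0 < a) (hr : 0 < r) :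
    Integrable (fun x => x ^ 2) (ProbabilityTheory.gammaMeasure a r) := by
  refine (lintegral_ofReal_ne_top_iff_integrable (by fun_prop)
    (ae_of_all _ fun x => sq_nonneg x)).mp ?_
  rw [lintegral_ofReal_sq_gammaMeasure ha hr]
  exact ENNReal.ofReal_ne_top

lemma integrable_id_gammaMeasure {a r : ℝ} (ha : 0 < a) (hr : 0 < r) :
    Integrable (fun x => x) (ProbabilityTheory.gammaMeasure a r) := by
  refine (lintegral_ofReal_ne_top_iff_integrable (by fun_prop)
    ((ae_gammaMeasure_pos a r).mono fun x hx => hx.le)).mp ?_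
  rw [lintegral_ofReal_gammaMeasure ha hr]
  exact ENNReal.ofReal_ne_top

lemma integral_sq_gammaMeasure {a r : ℝ} (ha : 0 < a) (hr : 0 < r) :
    ∫ x, x ^ 2 ∂ProbabilityTheory.gammaMeasure a r = a * (a + 1) / r ^ 2 := by
  rw [integral_eq_lintegral_of_nonneg_ae (ae_of_all _ fun x => sq_nonneg x) (by fun_prop),
    lintegral_ofReal_sq_gammaMeasure ha hr, ENNReal.toReal_ofReal (by positivity)]

lemma integral_id_gammaMeasure {a r : ℝ} (ha : 0 < a) (hr : 0 < r) :
    ∫ x, x ∂ProbabilityTheory.gammaMeasure a r = a / r := by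
  rw [integral_eq_lintegral_of_nonneg_ae
    ((ae_gammaMeasure_pos a r).mono fun x hx => hx.le) (by fun_prop),
    lintegral_ofReal_gammaMeasure ha hr, ENNReal.toReal_ofReal (by positivity)]

/-- An exponential law is close to the point mass at its mean. -/
lemma norm_charFun_expMeasure_sub_le {r : ℝ} (hr : 0 < r) (s : ℝ) :
    ‖charFun (ProbabilityTheory.expMeasure r) s - charFun (Measure.dirac (1 / r)) s‖
      ≤ 9 * s ^ 2 * (1 / r) ^ 2 := by
  have hP := ProbabilityTheory.isProbabilityMeasure_expMeasure hr
  have hid : Integrable (fun x : ℝ => x) (ProbabilityTheory.expMeasure r) :=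
    integrable_id_gammaMeasure one_pos hr
  have hsq : Integrable (fun x : ℝ => x ^ 2) (ProbabilityTheory.expMeasure r) :=
    integrable_sq_gammaMeasure one_pos hr
  have hexp : Integrable (fun x : ℝ => Complex.exp (s * x * Complex.I))
      (ProbabilityTheory.expMeasure r) := by
    refine Integrable.of_bound (by fun_prop) 1 (ae_of_all _ fun x => ?_)
    rw [← Complex.ofReal_mul, Complex.norm_exp_ofReal_mul_I]
  have hidc : Integrable (fun x : ℝ => (s : ℂ) * x * Complex.I)
      (ProbabilityTheory.expMeasure r) := (hid.ofReal.const_mul _).mul_const _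
  have h1 : ∫ x : ℝ, ((s : ℂ) * x * Complex.I) ∂ProbabilityTheory.expMeasure r
      = s * (1 / r : ℝ) * Complex.I := by
    rw [integral_mul_const, integral_const_mul, integral_complex_ofReal]
    congr 3
    exact integral_id_gammaMeasure one_pos hr
  have h2 : ∫ x : ℝ, x ^ 2 ∂ProbabilityTheory.expMeasure r = 2 * (1 / r) ^ 2 :=
    (integral_sq_gammaMeasure one_pos hr).trans (by ring)
  have h3 : charFun (ProbabilityTheory.expMeasure r) s - charFun (Measure.dirac (1 / r)) s
      = ∫ x : ℝ, (Complex.exp (s * x * Complex.I) - 1 - s * x * Complex.I)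
          ∂ProbabilityTheory.expMeasure r
        - (Complex.exp (((s * (1 / r) : ℝ) : ℂ) * Complex.I) - 1
            - ((s * (1 / r) : ℝ) : ℂ) * Complex.I) := by
    rw [integral_sub (f := fun x : ℝ => Complex.exp (s * x * Complex.I) - 1)
      (hexp.sub (integrable_const _)) hidc, integral_sub hexp (integrable_const _), h1, charFun_apply_real, charFun_dirac_real]
    simp
  rw [h3]
  refine (norm_sub_le _ _).trans ?_
  have h4 := norm_exp_mul_I_sub_one_sub_le (s * (1 / r))
  have h5 : ‖∫ x : ℝ, (Complex.exp (s * x * Complex.I) - 1 - s * x * Complex.I)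
          ∂ProbabilityTheory.expMeasure r‖ ≤ 3 * s ^ 2 * (2 * (1 / r) ^ 2) := by
    rw [← h2, ← integral_const_mul]
    refine norm_integral_le_of_norm_le (hsq.const_mul _) (ae_of_all _ fun x => ?_)
    have := norm_exp_mul_I_sub_one_sub_le (s * x)
    push_cast at this
    linarith [mul_pow s x 2]
  nlinarith

/-! ### Averaged characters -/

/-- The average of the characters `x ↦ exp (i ∑ s_l x_{j l})` over all maps `j`. -/
def avgChar {k n : ℕ} (s : Fin k → ℝ) (x : Fin n → ℝ) : ℂ :=
  ∏ l, ((n : ℂ)⁻¹ * ∑ i, Complex.exp (s l * x i * Complex.I))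

/-- The frequency obtained by placing `s l` at the coordinate `j l`. -/
def pushFreq {k n : ℕ} (s : Fin k → ℝ) (j : Fin k → Fin n) (i : Fin n) : ℝ :=
  ∑ l, if j l = i then s l else 0

lemma sum_pushFreq_mul {k n : ℕ} (s : Fin k → ℝ) (j : Fin k → Fin n) (x : Fin n → ℝ) :
    ∑ i, pushFreq s j i * x i = ∑ l, s l * x (j l) := by
  simp_rw [pushFreq, Finset.sum_mul]
  rw [Finset.sum_comm]
  refine Finset.sum_congr rfl fun l _ => ?_
  simp [ite_mul]

lemma sum_abs_pushFreq_le {k n : ℕ} (s : Fin k → ℝ) (j : Fin k → Fin n) :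
    ∑ i, |pushFreq s j i| ≤ ∑ l, |s l| := by
  calc ∑ i, |pushFreq s j i| ≤ ∑ i, ∑ l, |if j l = i then s l else 0| :=
        Finset.sum_le_sum fun i _ => Finset.abs_sum_le_sum_abs _ _
    _ = ∑ l, |s l| := by
        rw [Finset.sum_comm]
        refine Finset.sum_congr rfl fun l _ => ?_
        simp [apply_ite abs]

lemma avgChar_eq_sum {k n : ℕ} (s : Fin k → ℝ) (x : Fin n → ℝ) :
    avgChar s x = ((n : ℂ)⁻¹) ^ k * ∑ j : Fin k → Fin n, piChar (pushFreq s j) x := by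
  rw [avgChar, Finset.prod_mul_distrib, prod_const, card_univ, Fintype.card_fin,
    Finset.prod_univ_sum, Fintype.piFinset_univ]
  congr 1
  refine Finset.sum_congr rfl fun j _ => ?_
  rw [piChar, sum_pushFreq_mul, ← Complex.exp_sum]
  push_cast
  rw [Finset.sum_mul]

lemma integral_avgChar {k n : ℕ} (s : Fin k → ℝ) (μ : Measure (Fin n → ℝ)) [IsFiniteMeasure μ] :
    ∫ x, avgChar s x ∂μ
      = ((n : ℂ)⁻¹) ^ k * ∑ j : Fin k → Fin n, ∫ x, piChar (pushFreq s j) x ∂μ := by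
  simp_rw [avgChar_eq_sum]
  rw [integral_const_mul, integral_finsetSum _ fun j _ => integrable_piChar μ _]

lemma norm_inv_natCast_pow_mul_sum_le {k n : ℕ} (hn : n ≠ 0) {B : ℝ} (a : (Fin k → Fin n) → ℂ)
    (ha : ∀ j, ‖a j‖ ≤ B) : ‖((n : ℂ)⁻¹) ^ k * ∑ j, a j‖ ≤ B := by
  have h := (norm_sum_le univ a).trans (Finset.sum_le_sum fun j (_ : j ∈ univ) => ha j)
  rw [sum_const, card_univ, Fintype.card_fun, Fintype.card_fin, Fintype.card_fin,
    nsmul_eq_mul] at h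
  rw [norm_mul, norm_pow, norm_inv, Complex.norm_natCast, inv_pow,
    inv_mul_le_iff₀ (by positivity)]
  exact_mod_cast h

/-- The sum `∑ exp (i s (V_n - V_j))` over `j < n`, where `V` are the partial sums of `μ`. -/
def stepSum (μ : ℕ → ℝ) (s : ℝ) (n : ℕ) : ℂ :=
  ∑ j ∈ range n, Complex.exp
    (((s * (∑ i ∈ range n, μ i - ∑ i ∈ range j, μ i) : ℝ) : ℂ) * Complex.I)

lemma stepSum_succ (μ : ℕ → ℝ) (s : ℝ) (n : ℕ) :
    stepSum μ s (n + 1) = Complex.exp (s * μ n * Complex.I) * (1 + stepSum μ s n) := by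
  rw [stepSum, Finset.sum_range_succ, stepSum, mul_add, Finset.mul_sum, add_comm, mul_one]
  congr 1
  · rw [Finset.sum_range_succ]
    push_cast
    ring_nf
  · refine Finset.sum_congr rfl fun j _ => ?_
    rw [← Complex.exp_add, Finset.sum_range_succ]
    push_cast
    ring_nf

lemma ae_peeledMeasure_dirac (μ : ℕ → ℝ) (s : ℝ) (n : ℕ) :
    ∀ᵐ x ∂peeledMeasure (fun m => Measure.dirac (μ m)) n,
      ∑ i, Complex.exp (s * x i * Complex.I) = stepSum μ s n := by
  induction n with
  | zero => simp [stepSum]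
  | succ n ih =>
    set S : Set (Fin (n + 1) → ℝ) :=
      {x | ¬ ∑ i, Complex.exp (s * x i * Complex.I) = stepSum μ s (n + 1)} with hS
    have hSm : MeasurableSet S :=
      (measurableSet_eq_fun (by fun_prop) measurable_const).compl
    rw [ae_iff, ← lintegral_indicator_one hSm,
      lintegral_peeledMeasure_succ _ (measurable_one.indicator hSm)]
    refine mul_eq_zero_of_right _ (Finset.sum_eq_zero fun j _ => ?_)
    rw [lintegral_dirac]
    refine (lintegral_congr_ae ?_).trans lintegral_zero
    filter_upwards [ih] with z hz
    refine Set.indicator_of_notMem ?_ _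
    simp only [hS, Set.mem_ofPred_eq, not_not]
    rw [Fin.sum_univ_succAbove _ j, stepSum_succ, ← hz, mul_add, mul_one, Finset.mul_sum]
    simp only [Fin.insertNth_apply_same, Fin.insertNth_apply_succAbove]
    congr 1
    refine Finset.sum_congr rfl fun i _ => ?_
    rw [← Complex.exp_add]
    push_cast
    ring_nf

lemma integral_avgChar_peeledMeasure_dirac {k n : ℕ} (μ : ℕ → ℝ) (s : Fin k → ℝ) :
    ∫ x, avgChar s x ∂peeledMeasure (fun m => Measure.dirac (μ m)) n
      = ∏ l, ((n : ℂ)⁻¹ * stepSum μ (s l) n) := by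
  have h : ∀ᵐ x ∂peeledMeasure (fun m => Measure.dirac (μ m)) n,
      avgChar s x = ∏ l, ((n : ℂ)⁻¹ * stepSum μ (s l) n) := by
    filter_upwards [ae_all_iff.mpr fun l => ae_peeledMeasure_dirac μ (s l) n] with x hx
    simp_rw [avgChar, hx]
  rw [integral_congr_ae h]
  simp

/-- The averaged characters of the exponential peeled measure are close to those of the
deterministic one. -/
lemma norm_integral_avgChar_peeledMeasure_expMeasure_sub_le {k n : ℕ} (hn : n ≠ 0) {r : ℕ → ℝ}
    (hr : ∀ m, 0 < r m) (s : Fin k → ℝ) :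
    ‖∫ x, avgChar s x ∂peeledMeasure (fun m => ProbabilityTheory.expMeasure (r m)) n
        - ∏ l, ((n : ℂ)⁻¹ * stepSum (fun m => 1 / r m) (s l) n)‖
      ≤ 9 * (∑ l, |s l|) ^ 2 * ∑ m ∈ range n, (1 / r m) ^ 2 := by
  have hP : ∀ m, IsProbabilityMeasure (ProbabilityTheory.expMeasure (r m)) :=
    fun m => ProbabilityTheory.isProbabilityMeasure_expMeasure (hr m)
  rw [← integral_avgChar_peeledMeasure_dirac, integral_avgChar, integral_avgChar, ← mul_sub,
    ← Finset.sum_sub_distrib]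
  refine norm_inv_natCast_pow_mul_sum_le hn _ fun j => ?_
  rw [Finset.mul_sum]
  refine norm_integral_piChar_peeledMeasure_sub_le _ _ (fun m u hu => ?_) n _
    (sum_abs_pushFreq_le s j)
  refine (norm_charFun_expMeasure_sub_le (hr m) u).trans ?_
  have := sq_le_sq' (abs_le.mp hu).1 (abs_le.mp hu).2
  gcongr

/-! ### From the exponential density to the uniform distribution -/

lemma lintegral_orthantMeasure_smul {n : ℕ} {u : ℝ} (hu : 0 < u) {f : (Fin n → ℝ) → ℝ≥0∞}
    (hf : Measurable f) :
    ∫⁻ x, f (u • x) ∂orthantMeasure n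
      = ENNReal.ofReal ((u ^ n)⁻¹) * ∫⁻ x, f x ∂orthantMeasure n := by
  have hO : MeasurableSet (Set.univ.pi fun _ : Fin n => Set.Ioi (0 : ℝ)) :=
    MeasurableSet.univ_pi fun _ => measurableSet_Ioi
  have h1 : ∀ x : Fin n → ℝ, (Set.univ.pi fun _ => Set.Ioi 0).indicator (fun x => f (u • x)) x
      = (Set.univ.pi fun _ => Set.Ioi 0).indicator f (u • x) := by
    intro x
    have : x ∈ (Set.univ.pi fun _ : Fin n => Set.Ioi (0 : ℝ))
        ↔ u • x ∈ (Set.univ.pi fun _ : Fin n => Set.Ioi (0 : ℝ)) := by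
      simp [Set.mem_pi, hu]
    by_cases hx : x ∈ (Set.univ.pi fun _ : Fin n => Set.Ioi (0 : ℝ))
    · rw [Set.indicator_of_mem hx, Set.indicator_of_mem (this.mp hx)]
    · rw [Set.indicator_of_notMem hx, Set.indicator_of_notMem (this.not.mp hx)]
  have h2 := Measure.map_addHaar_smul (volume : Measure (Fin n → ℝ)) hu.ne'
  rw [Module.finrank_fin_fun, abs_of_pos (by positivity)] at h2
  rw [orthantMeasure_eq_restrict, ← lintegral_indicator hO, ← lintegral_indicator hO,
    lintegral_congr h1, ← lintegral_map (hf.indicator hO) (measurable_const_smul u), h2,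
    lintegral_smul_measure, smul_eq_mul]

lemma lintegral_Ioi_mul_exp {b a : ℝ} (hb : 0 < b) :
    ∫⁻ u in Set.Ioi a, ENNReal.ofReal (b * Real.exp (-(b * u)))
      = ENNReal.ofReal (Real.exp (-(b * a))) := by
  have hI := integrableOn_exp_mul_Ioi (neg_lt_zero.mpr hb) a
  simp only [neg_mul] at hI
  rw [← ofReal_integral_eq_lintegral_ofReal (hI.const_mul b)
    (ae_of_all _ fun u => by positivity), integral_const_mul]
  have := integral_exp_mul_Ioi (neg_lt_zero.mpr hb) a
  simp only [neg_mul] at this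
  rw [this]
  congr 1
  field_simp

lemma lintegral_gammaMeasure_ball {q : ℝ} (hq : 1 < q) {n : ℕ} (hn : n ≠ 0) {R : ℝ} (hR : 0 < R)
    {g : (Fin n → ℝ) → ℝ≥0∞} (hg : Measurable g) :
    ∫⁻ u, ∫⁻ x in {x | lorentzNorm q x ≤ R}, g (u • x) ∂orthantMeasure n
        ∂ProbabilityTheory.gammaMeasure (n + 1) n
      = ENNReal.ofReal ((n : ℝ) ^ n / Real.Gamma (n + 1)) *
        ∫⁻ x, ENNReal.ofReal (Real.exp (-(n / R * lorentzNorm q x))) * g x ∂orthantMeasure n := by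
  have hn0 : (0 : ℝ) < n := by positivity
  have hnorm : Measurable fun x : Fin n → ℝ => lorentzNorm q x :=
    (continuous_lorentzNorm hq n).measurable
  have hB : MeasurableSet {x : Fin n → ℝ | lorentzNorm q x ≤ R} :=
    measurableSet_le hnorm measurable_const
  set F : ℝ → (Fin n → ℝ) → ℝ≥0∞ :=
    fun u => Set.indicator {y | lorentzNorm q y ≤ u * R} g with hF
  have hFm : ∀ u, Measurable (F u) := fun u =>
    hg.indicator (measurableSet_le hnorm measurable_const)
  have hFm2 : Measurable (Function.uncurry F) := by
    have : Function.uncurry F = Set.indicator {p : ℝ × (Fin n → ℝ) | lorentzNorm q p.2 ≤ p.1 * R}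
        (fun p => g p.2) := by
      ext p; rfl
    rw [this]
    exact (hg.comp measurable_snd).indicator
      (measurableSet_le (hnorm.comp measurable_snd) (measurable_fst.mul_const R))
  have h1 : ∀ u : ℝ, 0 < u → ∫⁻ x in {x | lorentzNorm q x ≤ R}, g (u • x) ∂orthantMeasure n
      = ENNReal.ofReal ((u ^ n)⁻¹) * ∫⁻ y, F u y ∂orthantMeasure n := by
    intro u hu
    rw [← lintegral_orthantMeasure_smul hu (hFm u), ← lintegral_indicator hB]
    refine lintegral_congr fun x => ?_
    have : x ∈ {x : Fin n → ℝ | lorentzNorm q x ≤ R}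
        ↔ u • x ∈ {y : Fin n → ℝ | lorentzNorm q y ≤ u * R} := by
      simp only [Set.mem_ofPred_eq, lorentzNorm_smul q hu.le, mul_le_mul_iff_right₀ hu]
    by_cases hx : x ∈ {x : Fin n → ℝ | lorentzNorm q x ≤ R}
    · rw [Set.indicator_of_mem hx, hF]
      exact (Set.indicator_of_mem (this.mp hx) g).symm
    · rw [Set.indicator_of_notMem hx, hF]
      exact (Set.indicator_of_notMem (this.not.mp hx) g).symm
  have hw : Measurable fun u : ℝ => ENNReal.ofReal (n * Real.exp (-(n * u))) := by fun_prop
  rw [lintegral_gammaMeasure (Measurable.lintegral_prod_right'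
    (f := fun p : ℝ × (Fin n → ℝ) => g (p.1 • p.2)) (by fun_prop))]
  calc _ = ∫⁻ u in Set.Ioi 0, ENNReal.ofReal ((n : ℝ) ^ n / Real.Gamma (n + 1)) *
          ∫⁻ y, ENNReal.ofReal (n * Real.exp (-(n * u))) * F u y ∂orthantMeasure n := by
        refine setLIntegral_congr_fun measurableSet_Ioi fun u hu => ?_
        have hu : 0 < u := hu
        have hΓ := Real.Gamma_pos_of_pos (s := n + 1) (by positivity)
        rw [h1 u hu, lintegral_const_mul _ (hFm u), ← mul_assoc, ← mul_assoc,
          ← ENNReal.ofReal_mul (by positivity), ← ENNReal.ofReal_mul (by positivity)]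
        congr 2
        rw [add_sub_cancel_right, Real.rpow_natCast, Real.rpow_add_one hn0.ne', Real.rpow_natCast]
        field_simp
    _ = ENNReal.ofReal ((n : ℝ) ^ n / Real.Gamma (n + 1)) *
          ∫⁻ y, (∫⁻ u in Set.Ioi 0, ENNReal.ofReal (n * Real.exp (-(n * u))) * F u y)
            ∂orthantMeasure n := by
        rw [lintegral_const_mul' _ _ ENNReal.ofReal_ne_top, lintegral_lintegral_swap]
        exact ((hw.comp measurable_fst).mul hFm2).aemeasurable
    _ = _ := by
        congr 1
        refine lintegral_congr_ae ?_
        refine ae_of_all _ fun y => ?_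
        have hy := lorentzNorm_nonneg q y
        have h2 : ∀ u : ℝ, ENNReal.ofReal (n * Real.exp (-(n * u))) * F u y
            = (Set.Ici (lorentzNorm q y / R)).indicator
              (fun u => ENNReal.ofReal (n * Real.exp (-(n * u)))) u * g y := by
          intro u
          by_cases hu : lorentzNorm q y / R ≤ u
          · rw [Set.indicator_of_mem (by exact hu), hF]
            simp only
            rw [Set.indicator_of_mem]
            exact (div_le_iff₀ hR).mp hu
          · rw [Set.indicator_of_notMem (by exact hu), hF, zero_mul]
            simp only
            rw [Set.indicator_of_notMem, mul_zero]
            exact fun h => hu ((div_le_iff₀ hR).mpr h)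
        simp only [h2]
        rw [lintegral_mul_const _ (hw.indicator measurableSet_Ici),
          lintegral_indicator measurableSet_Ici, Measure.restrict_restrict measurableSet_Ici,
          show n / R * lorentzNorm q y = n * (lorentzNorm q y / R) by ring,
          ← lintegral_Ioi_mul_exp hn0]
        congr 1
        refine setLIntegral_congr ?_
        refine (Filter.EventuallyEq.inter Ioi_ae_eq_Ici.symm Filter.EventuallyEq.rfl).trans ?_
        rw [Set.inter_eq_left.mpr (Set.Ioi_subset_Ioi (by positivity))]
        exact Filter.EventuallyEq.rfl

/-- The uniform distribution on the part of a Lorentz ball in the positive orthant. -/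
def orthantUnif (q R : ℝ) (n : ℕ) : Measure (Fin n → ℝ) :=
  (orthantMeasure n {x | lorentzNorm q x ≤ R})⁻¹ •
    (orthantMeasure n).restrict {x | lorentzNorm q x ≤ R}

lemma measurableSet_lorentzNorm_le {q : ℝ} (hq : 1 < q) (R : ℝ) (n : ℕ) :
    MeasurableSet {x : Fin n → ℝ | lorentzNorm q x ≤ R} :=
  measurableSet_le (continuous_lorentzNorm hq n).measurable measurable_const

lemma isProbabilityMeasure_orthantUnif {q R : ℝ} {n : ℕ}
    (h0 : orthantMeasure n {x | lorentzNorm q x ≤ R} ≠ 0)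
    (h1 : orthantMeasure n {x | lorentzNorm q x ≤ R} ≠ ⊤) :
    IsProbabilityMeasure (orthantUnif q R n) := by
  refine ⟨?_⟩
  rw [orthantUnif, Measure.smul_apply, Measure.restrict_apply_univ, smul_eq_mul,
    ENNReal.inv_mul_cancel h0 h1]

lemma ae_orthantUnif {q : ℝ} (hq : 1 < q) (R : ℝ) (n : ℕ) :
    ∀ᵐ x ∂orthantUnif q R n, lorentzNorm q x ≤ R ∧ ∀ i, 0 < x i := by
  refine Measure.ae_smul_measure ?_ _
  filter_upwards [ae_restrict_mem (measurableSet_lorentzNorm_le hq R n),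
    ae_restrict_of_ae (ae_orthantMeasure_pos n)] with x h1 h2
  exact ⟨h1, h2⟩

/-- A random dilation of the uniform distribution is the exponential peeled measure. -/
lemma peeledMeasure_expMeasure_eq_map {q : ℝ} (hq : 1 < q) {n : ℕ} (hn : n ≠ 0) {R : ℝ}
    (hR : 0 < R) (h0 : orthantMeasure n {x | lorentzNorm q x ≤ R} ≠ 0)
    (h1 : orthantMeasure n {x | lorentzNorm q x ≤ R} ≠ ⊤) :
    peeledMeasure (fun m => ProbabilityTheory.expMeasure (n / R * weightSum q (m + 1))) n
      = Measure.map (fun p : ℝ × (Fin n → ℝ) => p.1 • p.2)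
        ((ProbabilityTheory.gammaMeasure (n + 1) n).prod (orthantUnif q R n)) := by
  have hn0 : (0 : ℝ) < n := by positivity
  have hΓ := ProbabilityTheory.isProbabilityMeasure_gammaMeasure
    (a := n + 1) (r := n) (by positivity) hn0
  have hU := isProbabilityMeasure_orthantUnif h0 h1
  obtain ⟨Z, hZ⟩ := exists_lintegral_exp_lorentzNorm hq (div_pos hn0 hR) n
  set Q := peeledMeasure (fun m => ProbabilityTheory.expMeasure (n / R * weightSum q (m + 1))) n
  have hP : ∀ m, IsProbabilityMeasure
      (ProbabilityTheory.expMeasure (n / R * weightSum q (m + 1))) := fun m =>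
    ProbabilityTheory.isProbabilityMeasure_expMeasure
      (mul_pos (div_pos hn0 hR) (weightSum_pos q m))
  have hQ : IsProbabilityMeasure Q := by infer_instance
  have hsm : Measurable fun p : ℝ × (Fin n → ℝ) => p.1 • p.2 := by fun_prop
  have key : ∃ K : ℝ≥0∞, ∀ g : (Fin n → ℝ) → ℝ≥0∞, Measurable g →
      ∫⁻ x, g x ∂Measure.map (fun p : ℝ × (Fin n → ℝ) => p.1 • p.2)
        ((ProbabilityTheory.gammaMeasure (n + 1) n).prod (orthantUnif q R n))
      = K * ∫⁻ x, g x ∂Q := by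
    refine ⟨(orthantMeasure n {x | lorentzNorm q x ≤ R})⁻¹ *
      (ENNReal.ofReal ((n : ℝ) ^ n / Real.Gamma (n + 1)) * Z), fun g hg => ?_⟩
    rw [lintegral_map hg hsm]
    refine (lintegral_prod _ (hg.comp hsm).aemeasurable).trans ?_
    rw [mul_assoc, mul_assoc, ← hZ g hg, ← lintegral_gammaMeasure_ball hq hn hR hg,
      ← lintegral_const_mul' _ _ (ENNReal.inv_ne_top.mpr h0)]
    refine lintegral_congr fun u => ?_
    rw [orthantUnif, lintegral_smul_measure, smul_eq_mul]
    rfl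
  obtain ⟨K, hK⟩ := key
  have hM := Measure.isProbabilityMeasure_map
    (μ := (ProbabilityTheory.gammaMeasure (n + 1) n).prod (orthantUnif q R n)) hsm.aemeasurable
  have hK1 : K = 1 := by
    have := hK (fun _ => 1) measurable_const
    simpa using this.symm
  ext s hs
  have := hK (s.indicator 1) (measurable_one.indicator hs)
  rw [lintegral_indicator_one hs, lintegral_indicator_one hs, hK1, one_mul] at this
  exact this.symm

lemma norm_prod_sub_prod_le {k : ℕ} (a b : Fin k → ℂ) (ha : ∀ l, ‖a l‖ ≤ 1)
    (hb : ∀ l, ‖b l‖ ≤ 1) : ‖∏ l, a l - ∏ l, b l‖ ≤ ∑ l, ‖a l - b l‖ := by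
  induction k with
  | zero => simp
  | succ k ih =>
    rw [Fin.prod_univ_succ, Fin.prod_univ_succ, Fin.sum_univ_succ]
    have h1 := ih (fun l => a l.succ) (fun l => b l.succ) (fun l => ha _) fun l => hb _
    have h2 : ‖∏ l : Fin k, b l.succ‖ ≤ 1 := by
      rw [norm_prod]
      exact Finset.prod_le_one (fun _ _ => norm_nonneg _) fun _ _ => hb _
    calc _ = ‖(a 0 - b 0) * ∏ l : Fin k, b l.succ
          + a 0 * (∏ l : Fin k, a l.succ - ∏ l : Fin k, b l.succ)‖ := by ring_nf
      _ ≤ ‖a 0 - b 0‖ * ‖∏ l : Fin k, b l.succ‖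
          + ‖a 0‖ * ‖∏ l : Fin k, a l.succ - ∏ l : Fin k, b l.succ‖ := by
        rw [← norm_mul, ← norm_mul]; exact norm_add_le _ _
      _ ≤ ‖a 0 - b 0‖ * 1 + 1 * ∑ l : Fin k, ‖a l.succ - b l.succ‖ := by
        gcongr; exact ha 0
      _ = _ := by ring

lemma norm_exp_mul_I_sub_exp_le (a b : ℝ) :
    ‖Complex.exp (a * Complex.I) - Complex.exp (b * Complex.I)‖ ≤ |a - b| := by
  have h : Complex.exp (a * Complex.I) - Complex.exp (b * Complex.I)
      = Complex.exp (b * Complex.I) * (Complex.exp (Complex.I * ((a - b : ℝ) : ℂ)) - 1) := by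
    rw [mul_sub, ← Complex.exp_add]
    push_cast
    ring_nf
  rw [h, norm_mul, Complex.norm_exp_ofReal_mul_I, one_mul]
  exact Real.norm_exp_I_mul_ofReal_sub_one_le

lemma norm_inv_mul_sum_exp_le {n : ℕ} (s : ℝ) (x : Fin n → ℝ) :
    ‖(n : ℂ)⁻¹ * ∑ i, Complex.exp (s * x i * Complex.I)‖ ≤ 1 := by
  rw [norm_mul, norm_inv, Complex.norm_natCast]
  refine inv_mul_le_one_of_le₀ ?_ (by positivity)
  refine (norm_sum_le _ _).trans ?_
  simp [← Complex.ofReal_mul, Complex.norm_exp_ofReal_mul_I]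

lemma norm_avgChar_smul_sub_le {k n : ℕ} (s : Fin k → ℝ) {x : Fin n → ℝ}
    (hsum : ∑ i, |x i| ≤ n) (u : ℝ) :
    ‖avgChar s (u • x) - avgChar s x‖ ≤ (∑ l, |s l|) * |u - 1| := by
  rw [Finset.sum_mul]
  refine (norm_prod_sub_prod_le _ _ (fun l => norm_inv_mul_sum_exp_le _ _)
    fun l => norm_inv_mul_sum_exp_le _ _).trans (Finset.sum_le_sum fun l _ => ?_)
  rw [← mul_sub, ← Finset.sum_sub_distrib, norm_mul, norm_inv, Complex.norm_natCast]
  have h : ‖∑ i, (Complex.exp (s l * (u • x) i * Complex.I)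
      - Complex.exp (s l * x i * Complex.I))‖ ≤ |s l| * |u - 1| * n := by
    refine (norm_sum_le _ _).trans ?_
    refine le_trans ?_ (mul_le_mul_of_nonneg_left hsum
      (mul_nonneg (abs_nonneg (s l)) (abs_nonneg (u - 1))))
    rw [Finset.mul_sum]
    refine Finset.sum_le_sum fun i _ => ?_
    have := norm_exp_mul_I_sub_exp_le (s l * (u • x) i) (s l * x i)
    push_cast at this
    refine this.trans (le_of_eq ?_)
    rw [← abs_mul, ← abs_mul, Pi.smul_apply, smul_eq_mul]
    ring_nf
  rcases Nat.eq_zero_or_pos n with rfl | hn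
  · simpa using mul_nonneg (abs_nonneg (s l)) (abs_nonneg (u - 1))
  · rw [inv_mul_le_iff₀ (by positivity)]
    linarith

lemma integral_abs_sub_one_gammaMeasure_le {n : ℕ} (hn : n ≠ 0) :
    ∫ u, |u - 1| ∂ProbabilityTheory.gammaMeasure (n + 1) n ≤ 2 / √n := by
  have hn0 : (0 : ℝ) < n := by positivity
  have hn1 : (1 : ℝ) ≤ n := by exact_mod_cast Nat.one_le_iff_ne_zero.mpr hn
  have hΓ := ProbabilityTheory.isProbabilityMeasure_gammaMeasure
    (a := n + 1) (r := n) (by positivity) hn0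
  have hid := integrable_id_gammaMeasure (a := n + 1) (r := n) (by positivity) hn0
  have hsq := integrable_sq_gammaMeasure (a := n + 1) (r := n) (by positivity) hn0
  have h2 : ∫ u : ℝ, (u ^ 2 - 2 * u + 1) ∂ProbabilityTheory.gammaMeasure (n + 1) n
      = ((n : ℝ) + 2) / n ^ 2 := by
    rw [integral_add (f := fun u : ℝ => u ^ 2 - 2 * u) (hsq.sub (hid.const_mul 2)) (integrable_const _),
      integral_sub hsq (hid.const_mul 2), integral_const_mul, integral_id_gammaMeasure
      (by positivity) hn0, integral_sq_gammaMeasure (by positivity) hn0]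
    simp
    field_simp
    ring
  have hs : 0 < √(n : ℝ) := Real.sqrt_pos.mpr hn0
  have hss : √(n : ℝ) ^ 2 = n := Real.sq_sqrt hn0.le
  have h3 : ∫ u, |u - 1| ∂ProbabilityTheory.gammaMeasure (n + 1) n
      ≤ ∫ u : ℝ, (1 / (2 * √n) + √n / 2 * (u ^ 2 - 2 * u + 1))
        ∂ProbabilityTheory.gammaMeasure (n + 1) n := by
    refine integral_mono (hid.sub (integrable_const 1)).abs
      ((integrable_const _).add (((hsq.sub (hid.const_mul 2)).add
        (integrable_const 1)).const_mul _)) fun u => ?_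
    have : 1 / (2 * √n) + √n / 2 * (u ^ 2 - 2 * u + 1) - |u - 1|
        = (√n * |u - 1| - 1) ^ 2 / (2 * √n) := by
      have := sq_abs (u - 1)
      field_simp
      linear_combination (-(√(n : ℝ)) ^ 2) * this
    have h4 : 0 ≤ (√n * |u - 1| - 1) ^ 2 / (2 * √n) := by positivity
    linarith
  refine h3.trans ?_
  rw [integral_add (g := fun u : ℝ => √n / 2 * (u ^ 2 - 2 * u + 1)) (integrable_const _)
    (((hsq.sub (hid.const_mul 2)).add (integrable_const 1)).const_mul _), integral_const_mul, h2]
  simp only [integral_const, probReal_univ, smul_eq_mul, one_mul]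
  have h5 : ((n : ℝ) + 2) / n ^ 2 ≤ 3 / n := by
    rw [div_le_div_iff₀ (by positivity) hn0]
    nlinarith
  calc _ ≤ 1 / (2 * √(n : ℝ)) + √n / 2 * (3 / n) := by gcongr
    _ = 2 / √n := by
      nth_rw 3 [← hss]
      field_simp
      norm_num

lemma continuous_avgChar {k n : ℕ} (s : Fin k → ℝ) :
    Continuous (avgChar s : (Fin n → ℝ) → ℂ) := by
  unfold avgChar
  fun_prop

lemma norm_avgChar_le {k n : ℕ} (s : Fin k → ℝ) (x : Fin n → ℝ) : ‖avgChar s x‖ ≤ 1 := by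
  rw [avgChar, norm_prod]
  exact Finset.prod_le_one (fun _ _ => norm_nonneg _) fun _ _ => norm_inv_mul_sum_exp_le _ _

/-- Averaged characters under the uniform and the peeled exponential measures are close. -/
lemma norm_integral_avgChar_orthantUnif_sub_le {q : ℝ} (hq : 1 < q) {k n : ℕ} (hn : n ≠ 0)
    (h0 : orthantMeasure n {x | lorentzNorm q x ≤ (n : ℝ) ^ (1 / q)} ≠ 0)
    (h1 : orthantMeasure n {x | lorentzNorm q x ≤ (n : ℝ) ^ (1 / q)} ≠ ⊤) (s : Fin k → ℝ) :
    ‖∫ x, avgChar s x ∂peeledMeasure (fun m => ProbabilityTheory.expMeasure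
          (n / (n : ℝ) ^ (1 / q) * weightSum q (m + 1))) n
        - ∫ x, avgChar s x ∂orthantUnif q ((n : ℝ) ^ (1 / q)) n‖
      ≤ (∑ l, |s l|) * (2 / √n) := by
  have hn0 : (0 : ℝ) < n := by positivity
  have hR : 0 < (n : ℝ) ^ (1 / q) := by positivity
  have hU := isProbabilityMeasure_orthantUnif h0 h1
  have hΓ := ProbabilityTheory.isProbabilityMeasure_gammaMeasure
    (a := n + 1) (r := n) (by positivity) hn0
  have hsm : Continuous fun p : ℝ × (Fin n → ℝ) => p.1 • p.2 := by fun_prop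
  set γ := ProbabilityTheory.gammaMeasure (n + 1) n
  set U := orthantUnif q ((n : ℝ) ^ (1 / q)) n
  have e1 : ∫ x, avgChar s x ∂U = ∫ p : ℝ × (Fin n → ℝ), avgChar s p.2 ∂γ.prod U := by
    rw [integral_fun_snd]; simp
  have i1 : Integrable (fun p : ℝ × (Fin n → ℝ) => avgChar s (p.1 • p.2)) (γ.prod U) :=
    Integrable.of_bound ((continuous_avgChar s).comp hsm).aestronglyMeasurable 1
      (ae_of_all _ fun p => norm_avgChar_le s _)
  have i2 : Integrable (fun p : ℝ × (Fin n → ℝ) => avgChar s p.2) (γ.prod U) :=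
    Integrable.of_bound ((continuous_avgChar s).comp continuous_snd).aestronglyMeasurable 1
      (ae_of_all _ fun p => norm_avgChar_le s _)
  have hid := integrable_id_gammaMeasure (a := n + 1) (r := n) (by positivity) hn0
  have i3 : Integrable (fun u : ℝ => |u - 1|) γ := (hid.sub (integrable_const 1)).abs
  rw [peeledMeasure_expMeasure_eq_map hq hn hR h0 h1, integral_map hsm.aemeasurable
    (continuous_avgChar s).aestronglyMeasurable, e1, ← integral_sub i1 i2]
  have hae : ∀ᵐ p ∂γ.prod U, ‖avgChar s (p.1 • p.2) - avgChar s p.2‖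
      ≤ (∑ l, |s l|) * |p.1 - 1| := by
    have hU2 : ∀ᵐ x ∂U, ∑ i, |x i| ≤ (n : ℝ) := by
      filter_upwards [ae_orthantUnif hq ((n : ℝ) ^ (1 / q)) n] with x hx
      have h2 := (sum_abs_le_lorentzNorm hq x).trans hx.1
      rw [Real.rpow_sub_one hn0.ne', div_mul_eq_mul_div, div_le_iff₀ hn0] at h2
      exact le_of_mul_le_mul_left h2 hR
    have := (Measure.quasiMeasurePreserving_snd (μ := γ) (ν := U)).ae hU2
    filter_upwards [this] with p hp
    exact norm_avgChar_smul_sub_le s hp p.1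
  refine (norm_integral_le_of_norm_le ((i3.comp_fst U).const_mul _) hae).trans ?_
  rw [integral_const_mul, integral_fun_fst (fun u : ℝ => |u - 1|)]
  simp only [probReal_univ, one_smul]
  exact mul_le_mul_of_nonneg_left (integral_abs_sub_one_gammaMeasure_le hn)
    (Finset.sum_nonneg fun _ _ => abs_nonneg _)

/-! ### Asymptotics of the partial sums -/

lemma tendsto_rpow_succ_sub_rpow_div {a : ℝ} :
    Tendsto (fun i : ℕ => (((i : ℝ) + 1) ^ a - (i : ℝ) ^ a) / ((i : ℝ) + 1) ^ (a - 1))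
      atTop (nhds a) := by
  have hd : HasDerivAt (fun t : ℝ => -(1 - t) ^ a) a 0 := by
    have h1 : HasDerivAt (fun t : ℝ => 1 - t) (-1) 0 := by
      simpa using (hasDerivAt_id (0 : ℝ)).const_sub 1
    have h2 := (h1.rpow_const (p := a) (Or.inl (by norm_num))).neg
    exact h2.congr_deriv (by simp)
  have hs := hd.tendsto_slope_zero
  have ht : Tendsto (fun i : ℕ => 1 / ((i : ℝ) + 1)) atTop (nhdsWithin 0 {0}ᶜ) := by
    refine tendsto_nhdsWithin_iff.mpr ⟨tendsto_one_div_add_atTop_nhds_zero_nat, ?_⟩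
    refine Eventually.of_forall fun i => ?_
    have : (1 : ℝ) / ((i : ℝ) + 1) ≠ 0 := by positivity
    simpa using this
  refine (hs.comp ht).congr fun i => ?_
  have hx : (0 : ℝ) < (i : ℝ) + 1 := by positivity
  have h3 : (1 : ℝ) - 1 / ((i : ℝ) + 1) = i / (i + 1) := by field_simp; ring
  simp only [Function.comp_apply, smul_eq_mul, zero_add, sub_zero, Real.one_rpow, h3]
  rw [Real.div_rpow (by positivity) hx.le, Real.rpow_sub_one hx.ne']
  have : 0 < ((i : ℝ) + 1) ^ a := by positivity
  field_simp
  ring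

lemma tendsto_sum_range_div_rpow {a L : ℝ} (ha : 0 < a) {f : ℕ → ℝ}
    (hf : Tendsto (fun i => f i / ((i : ℝ) + 1) ^ (a - 1)) atTop (nhds L)) :
    Tendsto (fun n : ℕ => (∑ i ∈ range n, f i) / (n : ℝ) ^ a) atTop (nhds (L / a)) := by
  set g : ℕ → ℝ := fun i => ((i : ℝ) + 1) ^ a - (i : ℝ) ^ a with hg
  have hgpos : ∀ i, 0 < g i := fun i =>
    sub_pos.mpr (Real.rpow_lt_rpow (by positivity) (by linarith) ha)
  have hgsum : ∀ n : ℕ, ∑ i ∈ range n, g i = (n : ℝ) ^ a := by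
    intro n
    have := Finset.sum_range_sub (fun i : ℕ => (i : ℝ) ^ a) n
    push_cast at this
    rw [Real.zero_rpow ha.ne', sub_zero] at this
    exact this
  have hlim : Tendsto (fun i => f i / g i) atTop (nhds (L / a)) := by
    refine (hf.div tendsto_rpow_succ_sub_rpow_div ha.ne').congr fun i => ?_
    have : 0 < ((i : ℝ) + 1) ^ (a - 1) := by positivity
    have := hgpos i
    simp only [Pi.div_apply, hg] at *
    field_simp
  have ho : (fun i => f i - L / a * g i) =o[atTop] g := by
    refine (Asymptotics.isLittleO_iff_tendsto fun i hi => absurd hi (hgpos i).ne').mpr ?_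
    have := hlim.sub_const (L / a)
    rw [sub_self] at this
    refine this.congr fun i => ?_
    have := (hgpos i).ne'
    field_simp
  have hat : Tendsto (fun n => ∑ i ∈ range n, g i) atTop atTop := by
    simp_rw [hgsum]
    exact (tendsto_rpow_atTop ha).comp tendsto_natCast_atTop_atTop
  have hsum := (ho.sum_range (fun i => (hgpos i).le) hat).tendsto_div_nhds_zero
  simp_rw [hgsum] at hsum
  have h2 := hsum.add_const (L / a)
  rw [zero_add] at h2
  refine h2.congr' ?_
  filter_upwards [eventually_gt_atTop 0] with n hn
  have : (0 : ℝ) < (n : ℝ) ^ a := by positivity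
  rw [Finset.sum_sub_distrib, ← Finset.mul_sum, hgsum]
  field_simp
  ring

lemma tendsto_weightSum_div {q : ℝ} (hq : 1 < q) :
    Tendsto (fun n : ℕ => weightSum q n / (n : ℝ) ^ (1 / q)) atTop (nhds q) := by
  have hq0 : 0 < q := by linarith
  have h := tendsto_sum_range_div_rpow (a := 1 / q) (L := 1)
    (f := fun i => ((i : ℝ) + 1) ^ (1 / q - 1)) (by positivity) ?_
  · rw [one_div_one_div] at h
    exact h
  · refine tendsto_const_nhds.congr fun i => ?_
    rw [div_self]
    positivity

/-- The partial sums of the reciprocal weights. -/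
def recipSum (q : ℝ) (n : ℕ) : ℝ := ∑ i ∈ range n, 1 / weightSum q (i + 1)

lemma tendsto_recipSum_div {q : ℝ} (hq : 1 < q) :
    Tendsto (fun n : ℕ => recipSum q n / (n : ℝ) ^ (1 - 1 / q)) atTop (nhds (1 / (q - 1))) := by
  have hq0 : 0 < q := by linarith
  have ha : 0 < 1 - 1 / q := by
    rw [sub_pos, div_lt_one hq0]; exact hq
  have h := tendsto_sum_range_div_rpow (a := 1 - 1 / q) (L := 1 / q)
    (f := fun i => 1 / weightSum q (i + 1)) ha ?_
  · rw [show 1 / q / (1 - 1 / q) = 1 / (q - 1) by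
      have : q - 1 ≠ 0 := by linarith
      field_simp] at h
    exact h
  · have h1 := (((tendsto_weightSum_div hq).comp (tendsto_add_atTop_nat 1)).inv₀ hq0.ne')
    rw [one_div q]
    rw [one_div] at h1
    refine h1.congr fun i => ?_
    have hx : (0 : ℝ) < (i : ℝ) + 1 := by positivity
    have := weightSum_pos q i
    simp only [Function.comp_apply]
    push_cast
    rw [show (1 : ℝ) - q⁻¹ - 1 = -q⁻¹ by ring, Real.rpow_neg hx.le]
    have : 0 < ((i : ℝ) + 1) ^ q⁻¹ := by positivity
    field_simp

lemma tendsto_sum_sq_recip {q : ℝ} (hq : 1 < q) :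
    Tendsto (fun n : ℕ => ∑ m ∈ range n,
      (1 / ((n : ℝ) / (n : ℝ) ^ (1 / q) * weightSum q (m + 1))) ^ 2) atTop (nhds 0) := by
  have hq0 : 0 < q := by linarith
  have ha : 0 < 1 - 1 / q := by
    rw [sub_pos, div_lt_one hq0]; exact hq
  have hlim : Tendsto (fun n : ℕ => recipSum q n / (n : ℝ) ^ (1 - 1 / q)
      * ((n : ℝ) ^ (1 - 1 / q))⁻¹) atTop (nhds 0) := by
    have := (tendsto_recipSum_div hq).mul
      (((tendsto_rpow_atTop ha).comp tendsto_natCast_atTop_atTop).inv_tendsto_atTop)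
    rw [mul_zero] at this
    exact this
  refine tendsto_of_tendsto_of_tendsto_of_le_of_le' tendsto_const_nhds hlim
    (Eventually.of_forall fun n => Finset.sum_nonneg fun _ _ => sq_nonneg _) ?_
  filter_upwards [eventually_gt_atTop 0] with n hn
  have hn0 : (0 : ℝ) < n := by positivity
  have hc : (n : ℝ) / (n : ℝ) ^ (1 / q) = (n : ℝ) ^ (1 - 1 / q) := by
    rw [Real.rpow_sub hn0, Real.rpow_one]
  have hcpos : 0 < (n : ℝ) ^ (1 - 1 / q) := by positivity
  rw [hc, recipSum, div_mul_eq_mul_div, Finset.sum_mul, Finset.sum_div]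
  refine Finset.sum_le_sum fun m _ => ?_
  have hw := one_le_weightSum q m
  have hw0 := weightSum_pos q m
  rw [show (1 / ((n : ℝ) ^ (1 - 1 / q) * weightSum q (m + 1))) ^ 2
    = 1 / weightSum q (m + 1) * ((n : ℝ) ^ (1 - 1 / q))⁻¹ / (n : ℝ) ^ (1 - 1 / q)
      * (1 / weightSum q (m + 1)) by field_simp]
  refine mul_le_of_le_one_right (by positivity) ?_
  rw [div_le_one hw0]
  exact hw

/-! ### The limiting characteristic function -/

/-- The limiting profile of the ordered coordinates. -/
def profile (q u : ℝ) : ℝ := (1 - u ^ (1 - 1 / q)) / (q - 1)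

/-- The characteristic function of the absolute value of the limit law. -/
def profileChar (q s : ℝ) : ℂ := ∫ u in (0 : ℝ)..1, Complex.exp (s * profile q u * Complex.I)

lemma intervalIntegral_comp_floor (F : ℕ → ℂ) (n : ℕ) :
    ∫ v in (0 : ℝ)..n, F ⌊v⌋₊ = ∑ j ∈ range n, F j := by
  have hae : ∀ j : ℕ, ∀ᵐ v : ℝ, v ∈ Set.uIoc (j : ℝ) (j + 1 : ℕ) → F ⌊v⌋₊ = F j := by
    intro j
    have hne : ∀ᵐ v : ℝ, v ≠ (j + 1 : ℕ) := by
      simp [ae_iff]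
    filter_upwards [hne] with v hv hmem
    rw [Set.uIoc_of_le (by push_cast; linarith)] at hmem
    congr 1
    rw [Nat.floor_eq_iff ((Nat.cast_nonneg j).trans hmem.1.le)]
    refine ⟨hmem.1.le, ?_⟩
    have := lt_of_le_of_ne hmem.2 hv
    push_cast at this
    exact this
  have hmeas_int : ∀ j < n, IntervalIntegrable (fun v : ℝ => F ⌊v⌋₊) volume (j : ℕ) (j + 1 : ℕ) := by
    intro j _
    refine (intervalIntegrable_const (c := F j)).congr_ae ?_
    rw [Filter.EventuallyEq, ae_restrict_iff' measurableSet_uIoc]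
    filter_upwards [hae j] with v hv hm
    exact (hv hm).symm
  have := intervalIntegral.sum_integral_adjacent_intervals (a := fun j : ℕ => (j : ℝ)) hmeas_int
  rw [Nat.cast_zero] at this
  rw [← this]
  refine Finset.sum_congr rfl fun j _ => ?_
  rw [intervalIntegral.integral_congr_ae (hae j)]
  simp

lemma inv_mul_sum_eq_intervalIntegral (F : ℕ → ℂ) {n : ℕ} (hn : n ≠ 0) :
    (n : ℂ)⁻¹ * ∑ j ∈ range n, F j = ∫ u in (0 : ℝ)..1, F ⌊u * n⌋₊ := by
  have hn0 : (n : ℝ) ≠ 0 := by exact_mod_cast hn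
  rw [intervalIntegral.integral_comp_mul_right (fun v : ℝ => F ⌊v⌋₊) hn0, zero_mul, one_mul,
    intervalIntegral_comp_floor, Complex.real_smul]
  push_cast
  rfl

lemma tendsto_recipSum_floor {q : ℝ} (hq : 1 < q) {u : ℝ} (hu : 0 < u) :
    Tendsto (fun n : ℕ => recipSum q ⌊u * n⌋₊ / (n : ℝ) ^ (1 - 1 / q)) atTop
      (nhds (1 / (q - 1) * u ^ (1 - 1 / q))) := by
  have hq0 : 0 < q := by linarith
  have ha : 0 < 1 - 1 / q := by
    rw [sub_pos, div_lt_one hq0]; exact hq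
  have hfl : Tendsto (fun n : ℕ => ⌊u * n⌋₊) atTop atTop :=
    tendsto_nat_floor_atTop.comp (tendsto_natCast_atTop_atTop.const_mul_atTop hu)
  have h1 := (tendsto_recipSum_div hq).comp hfl
  have h2 : Tendsto (fun n : ℕ => ((⌊u * n⌋₊ : ℝ) / n) ^ (1 - 1 / q)) atTop
      (nhds (u ^ (1 - 1 / q))) :=
    ((tendsto_nat_floor_mul_div_atTop hu.le).comp tendsto_natCast_atTop_atTop).rpow_const
      (Or.inl hu.ne')
  refine (h1.mul h2).congr' ?_
  filter_upwards [hfl.eventually_gt_atTop 0, eventually_gt_atTop 0] with n h3 hn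
  have hm : (0 : ℝ) < (⌊u * n⌋₊ : ℝ) := by exact_mod_cast h3
  have hn0 : (0 : ℝ) < n := by positivity
  rw [Function.comp_apply, Real.div_rpow hm.le hn0.le]
  have : 0 < (⌊u * n⌋₊ : ℝ) ^ (1 - 1 / q) := by positivity
  field_simp

lemma tendsto_stepSum {q : ℝ} (hq : 1 < q) (s : ℝ) :
    Tendsto (fun n : ℕ => (n : ℂ)⁻¹ * stepSum
      (fun m => 1 / ((n : ℝ) / (n : ℝ) ^ (1 / q) * weightSum q (m + 1))) s n)
      atTop (nhds (profileChar q s)) := by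
  set F : ℕ → ℕ → ℂ := fun n j => Complex.exp
    (((s * ((recipSum q n - recipSum q j) / (n : ℝ) ^ (1 - 1 / q)) : ℝ) : ℂ) * Complex.I) with hF
  have h1 : ∀ᶠ n : ℕ in atTop, ∫ u in (0 : ℝ)..1, F n ⌊u * n⌋₊ = (n : ℂ)⁻¹ * stepSum
      (fun m => 1 / ((n : ℝ) / (n : ℝ) ^ (1 / q) * weightSum q (m + 1))) s n := by
    filter_upwards [eventually_gt_atTop 0] with n hn
    rw [← inv_mul_sum_eq_intervalIntegral _ hn.ne', stepSum]
    congr 1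
    have hn0 : (0 : ℝ) < n := by positivity
    have hc : (n : ℝ) / (n : ℝ) ^ (1 / q) = (n : ℝ) ^ (1 - 1 / q) := by
      rw [Real.rpow_sub hn0, Real.rpow_one]
    have hsum : ∀ j, ∑ i ∈ range j, 1 / ((n : ℝ) / (n : ℝ) ^ (1 / q) * weightSum q (i + 1))
        = recipSum q j / (n : ℝ) ^ (1 - 1 / q) := by
      intro j
      rw [recipSum, Finset.sum_div, hc]
      refine Finset.sum_congr rfl fun i _ => ?_
      rw [div_div, mul_comm]
    refine Finset.sum_congr rfl fun j _ => ?_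
    simp only [hF, hsum, sub_div]
  refine Tendsto.congr' h1 ?_
  refine intervalIntegral.tendsto_integral_filter_of_dominated_convergence (fun _ => 1)
    (Eventually.of_forall fun n => ?_) (Eventually.of_forall fun n => ae_of_all _ fun u _ => ?_)
    intervalIntegrable_const (ae_of_all _ fun u hu => ?_)
  · exact ((measurable_from_nat (f := F n)).comp
      (Nat.measurable_floor.comp (measurable_id.mul_const (n : ℝ)))).aestronglyMeasurable
  · exact (Complex.norm_exp_ofReal_mul_I _).le
  · rw [Set.uIoc_of_le zero_le_one] at hu
    have h2 := (tendsto_recipSum_div hq).sub (tendsto_recipSum_floor hq hu.1)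
    have h3 : 1 / (q - 1) - 1 / (q - 1) * u ^ (1 - 1 / q) = profile q u := by
      rw [profile]; ring
    rw [h3] at h2
    have h4 : Tendsto (fun n : ℕ => s * ((recipSum q n - recipSum q ⌊u * n⌋₊)
        / (n : ℝ) ^ (1 - 1 / q))) atTop (nhds (s * profile q u)) := by
      refine (h2.const_mul s).congr fun n => ?_
      rw [sub_div]
    have h5 : Continuous fun y : ℝ => Complex.exp ((y : ℂ) * Complex.I) := by fun_prop
    have := (h5.tendsto _).comp h4
    push_cast at this
    exact this

lemma continuous_profile {q : ℝ} (hq : 1 < q) : Continuous (profile q) := by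
  have hq0 : 0 < q := by linarith
  have ha : 0 ≤ 1 - 1 / q := by
    rw [sub_nonneg, div_le_one hq0]; exact hq.le
  have := Real.continuous_rpow_const ha
  unfold profile
  fun_prop

lemma intervalIntegral_exp_mul_density {q : ℝ} (hq : 1 < q) (s : ℝ) :
    ∫ y in (0 : ℝ)..(1 / (q - 1)), (((q / 2 * (1 - (q - 1) * y) ^ (1 / (q - 1)) : ℝ) : ℂ)
      * Complex.exp (s * y * Complex.I)) = profileChar q s / 2 := by
  have hq0 : 0 < q := by linarith
  have hq1 : 0 < q - 1 := by linarith
  have hL : 0 ≤ 1 / (q - 1) := by positivity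
  set v : ℝ → ℝ := fun y => (1 - (q - 1) * y) ^ (q / (q - 1)) with hv
  set v' : ℝ → ℝ := fun y => -(q * (1 - (q - 1) * y) ^ (1 / (q - 1))) with hv'
  have hexp : 1 ≤ q / (q - 1) := by rw [one_le_div hq1]; linarith
  have hexp' : q / (q - 1) - 1 = 1 / (q - 1) := by field_simp; ring
  have hd : ∀ y ∈ Set.uIcc 0 (1 / (q - 1)), HasDerivAt v (v' y) y := by
    intro y _
    have h1 : HasDerivAt (fun y : ℝ => 1 - (q - 1) * y) (-(q - 1)) y := by
      simpa using ((hasDerivAt_id y).const_mul (q - 1)).const_sub 1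
    have h2 := h1.rpow_const (p := q / (q - 1)) (Or.inr hexp)
    rw [hexp'] at h2
    convert h2 using 1
    simp only [hv']
    field_simp
  have hv'c : Continuous v' := by
    have := Real.continuous_rpow_const (q := 1 / (q - 1)) hL
    simp only [hv']
    exact ((this.comp (by fun_prop : Continuous fun y : ℝ => 1 - (q - 1) * y)).const_mul q).neg
  have hG : Continuous fun u : ℝ => Complex.exp (s * profile q u * Complex.I) := by
    have := continuous_profile hq
    fun_prop
  have hcv := intervalIntegral.integral_deriv_smul_comp hd hv'c.continuousOn hG
  have hv0 : v 0 = 1 := by simp [hv]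
  have hv1 : v (1 / (q - 1)) = 0 := by
    simp only [hv]
    rw [mul_one_div_cancel hq1.ne', sub_self, Real.zero_rpow (by linarith)]
  rw [hv0, hv1, intervalIntegral.integral_symm 0 1] at hcv
  rw [profileChar, eq_div_iff two_ne_zero, ← neg_inj, ← hcv, ← intervalIntegral.integral_mul_const,
    ← intervalIntegral.integral_neg]
  refine intervalIntegral.integral_congr fun y hy => ?_
  rw [Set.uIcc_of_le hL] at hy
  have hb : 0 ≤ 1 - (q - 1) * y := by
    have := (le_div_iff₀ hq1).mp hy.2
    linarith
  have hp : profile q (v y) = y := by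
    simp only [profile, hv]
    rw [← Real.rpow_mul hb, show q / (q - 1) * (1 - 1 / q) = 1 by field_simp, Real.rpow_one]
    field_simp
    ring
  simp only [Function.comp_apply, hp, Complex.real_smul, hv']
  push_cast
  ring

lemma charFun_limitMeasure {q : ℝ} (hq : 1 < q) (s : ℝ) :
    charFun (limitMeasure q) s = (profileChar q s + profileChar q (-s)) / 2 := by
  have hq1 : 0 < q - 1 := by linarith
  set L := 1 / (q - 1) with hLdef
  have hL : 0 ≤ L := by positivity
  set D : ℝ → ℝ := fun y => q / 2 * (1 - (q - 1) * |y|) ^ (1 / (q - 1)) with hD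
  have hDc : Continuous D := by
    have := Real.continuous_rpow_const (q := 1 / (q - 1)) hL
    exact (this.comp (by fun_prop : Continuous fun y : ℝ => 1 - (q - 1) * |y|)).const_mul _
  have hDm : Measurable (limitDensity q) := hDc.measurable.indicator measurableSet_Icc
  have hnn : ∀ y, 0 ≤ limitDensity q y := by
    intro y
    refine Set.indicator_nonneg (fun y hy => ?_) y
    have h1 : |y| ≤ 1 / (q - 1) := abs_le.mpr hy
    have := (le_div_iff₀ hq1).mp h1
    have h2 : 0 ≤ 1 - (q - 1) * |y| := by linarith
    positivity
  have hEc : Continuous fun y : ℝ => ((D y : ℂ) * Complex.exp (s * y * Complex.I)) := by fun_prop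
  have hmeas_int : ∀ a b, IntervalIntegrable
      (fun y : ℝ => ((D y : ℂ) * Complex.exp (s * y * Complex.I))) volume a b :=
    fun a b => hEc.intervalIntegrable a b
  rw [charFun_apply_real, limitMeasure, integral_withDensity_eq_integral_toReal_smul
    hDm.ennreal_ofReal (ae_of_all _ fun _ => ENNReal.ofReal_lt_top)]
  have h1 : ∀ y : ℝ, (ENNReal.ofReal (limitDensity q y)).toReal • Complex.exp (s * y * Complex.I)
      = (Set.Icc (-L) L).indicator
        (fun y : ℝ => ((D y : ℂ) * Complex.exp (s * y * Complex.I))) y := by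
    intro y
    rw [ENNReal.toReal_ofReal (hnn y), Complex.real_smul, limitDensity]
    by_cases hy : y ∈ Set.Icc (-L) L
    · rw [Set.indicator_of_mem hy, Set.indicator_of_mem hy]
    · rw [Set.indicator_of_notMem hy, Set.indicator_of_notMem hy]; simp
  simp_rw [h1]
  rw [integral_indicator measurableSet_Icc, integral_Icc_eq_integral_Ioc,
    ← intervalIntegral.integral_of_le (by linarith),
    ← intervalIntegral.integral_add_adjacent_intervals (hmeas_int _ 0) (hmeas_int 0 _)]
  have hpos : ∀ t : ℝ, ∫ y in (0 : ℝ)..L, ((D y : ℂ) * Complex.exp (t * y * Complex.I))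
      = profileChar q t / 2 := by
    intro t
    rw [← intervalIntegral_exp_mul_density hq t]
    refine intervalIntegral.integral_congr fun y hy => ?_
    rw [Set.uIcc_of_le hL] at hy
    simp only [hD, abs_of_nonneg hy.1]
  have hneg : ∫ y in (-L)..0, ((D y : ℂ) * Complex.exp (s * y * Complex.I))
      = profileChar q (-s) / 2 := by
    rw [← hpos (-s)]
    have := intervalIntegral.integral_comp_neg (a := 0) (b := L)
      (fun y : ℝ => ((D y : ℂ) * Complex.exp (s * y * Complex.I)))
    rw [neg_zero] at this
    rw [← this]
    refine intervalIntegral.integral_congr fun y _ => ?_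
    simp [hD]
  rw [hpos, hneg]
  ring

lemma isProbabilityMeasure_limitMeasure {q : ℝ} (hq : 1 < q) :
    IsProbabilityMeasure (limitMeasure q) := by
  have h := charFun_limitMeasure hq 0
  rw [charFun_zero] at h
  have h1 : profileChar q 0 = 1 := by simp [profileChar]
  rw [neg_zero, h1] at h
  have h2 : (limitMeasure q).real Set.univ = 1 := by
    have : (((limitMeasure q).real Set.univ : ℝ) : ℂ) = 1 := by rw [h]; norm_num
    exact_mod_cast this
  refine ⟨?_⟩
  rw [Measure.real] at h2
  rwa [ENNReal.toReal_eq_one_iff] at h2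

/-! ### Exchangeability -/

lemma measurePreserving_comp_perm_orthantUnif (q R : ℝ) {n : ℕ} (hq : 1 < q)
    (τ : Equiv.Perm (Fin n)) :
    MeasurePreserving (fun x : Fin n → ℝ => x ∘ τ) (orthantUnif q R n) (orthantUnif q R n) := by
  have h1 : MeasurePreserving (fun x : Fin n → ℝ => x ∘ τ) (orthantMeasure n)
      (orthantMeasure n) := by
    have h := measurePreserving_piCongrLeft (α := fun _ : Fin n => ℝ)
      (fun _ : Fin n => (volume : Measure ℝ).restrict (Set.Ioi 0)) τ.symm
    have he : (MeasurableEquiv.piCongrLeft (fun _ : Fin n => ℝ) τ.symm : (Fin n → ℝ) → Fin n → ℝ)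
        = fun x => x ∘ τ := by
      ext x i
      rw [MeasurableEquiv.coe_piCongrLeft]
      simpa using Equiv.piCongrLeft_apply_apply (P := fun _ : Fin n => ℝ) τ.symm x (τ i)
    rw [he] at h
    exact h
  have h2 := h1.restrict_preimage (measurableSet_lorentzNorm_le hq R n)
  have hpre : (fun x : Fin n → ℝ => x ∘ τ) ⁻¹' {x | lorentzNorm q x ≤ R}
      = {x | lorentzNorm q x ≤ R} := by
    ext x
    have := lorentzNorm_comp_perm q x τ
    simp only [Set.mem_preimage, Set.mem_ofPred_eq]
    exact this ▸ Iff.rfl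
  rw [hpre] at h2
  exact ⟨h2.measurable, by rw [orthantUnif, Measure.map_smul, h2.map_eq]⟩

lemma integral_piChar_pushFreq_eq {k n : ℕ} {U : Measure (Fin n → ℝ)}
    (hU : ∀ τ : Equiv.Perm (Fin n), MeasurePreserving (fun x : Fin n → ℝ => x ∘ τ) U U)
    (s : Fin k → ℝ) {j j₀ : Fin k → Fin n} (hj : Function.Injective j)
    (hj₀ : Function.Injective j₀) :
    ∫ x, piChar (pushFreq s j) x ∂U = ∫ x, piChar (pushFreq s j₀) x ∂U := by
  obtain ⟨τ, hτ⟩ := Equiv.Perm.exists_extending_pair j₀ j hj₀ hj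
  have h := integral_map (μ := U) (hU τ).measurable.aemeasurable
    (f := piChar (pushFreq s j₀)) (continuous_piChar _).aestronglyMeasurable
  rw [(hU τ).map_eq] at h
  rw [h]
  refine integral_congr_ae (ae_of_all _ fun x => ?_)
  simp [piChar, sum_pushFreq_mul, hτ]

lemma norm_integral_avgChar_sub_piChar_le {k n : ℕ} (hn : n ≠ 0) {U : Measure (Fin n → ℝ)}
    [IsProbabilityMeasure U]
    (hU : ∀ τ : Equiv.Perm (Fin n), MeasurePreserving (fun x : Fin n → ℝ => x ∘ τ) U U)
    (s : Fin k → ℝ) {j₀ : Fin k → Fin n} (hj₀ : Function.Injective j₀) :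
    ‖∫ x, avgChar s x ∂U - ∫ x, piChar (pushFreq s j₀) x ∂U‖
      ≤ 2 * (1 - (n.descFactorial k : ℝ) / (n : ℝ) ^ k) := by
  classical
  set A : (Fin k → Fin n) → ℂ := fun j => ∫ x, piChar (pushFreq s j) x ∂U with hA
  have hAle : ∀ j, ‖A j‖ ≤ 1 := fun j => by
    simpa using norm_integral_piChar_le U (pushFreq s j)
  have hnC : (n : ℂ) ≠ 0 := by exact_mod_cast hn
  have hnR : (0 : ℝ) < (n : ℝ) ^ k := by positivity
  have h1 : ∫ x, avgChar s x ∂U - A j₀ = ((n : ℂ)⁻¹) ^ k * ∑ j, (A j - A j₀) := by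
    rw [integral_avgChar, Finset.sum_sub_distrib, mul_sub]
    congr 1
    simp only [sum_const, card_univ, Fintype.card_fun, Fintype.card_fin, nsmul_eq_mul]
    push_cast
    rw [← mul_assoc, ← mul_pow, inv_mul_cancel₀ hnC, one_pow, one_mul]
  have hcard : (#{j : Fin k → Fin n | ¬ Function.Injective j} : ℝ)
      = (n : ℝ) ^ k - n.descFactorial k := by
    have h2 : #{j : Fin k → Fin n | Function.Injective j} = n.descFactorial k := by
      rw [← Fintype.card_subtype, Fintype.card_congr (Equiv.subtypeInjectiveEquivEmbedding _ _),
        Fintype.card_embedding_eq, Fintype.card_fin, Fintype.card_fin]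
    have h3 := Finset.card_filter_add_card_filter_not (s := (univ : Finset (Fin k → Fin n)))
      (fun j => Function.Injective j)
    rw [h2, card_univ, Fintype.card_fun, Fintype.card_fin, Fintype.card_fin] at h3
    have h4 : ((n ^ k : ℕ) : ℝ) = n.descFactorial k +
      (#{j : Fin k → Fin n | ¬ Function.Injective j} : ℝ) := by rw [← h3]; push_cast; rfl
    push_cast at h4
    linarith
  have h5 : ‖∑ j, (A j - A j₀)‖ ≤ 2 * ((n : ℝ) ^ k - n.descFactorial k) := by
    rw [← hcard]
    calc ‖∑ j, (A j - A j₀)‖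
        ≤ ∑ j, ‖A j - A j₀‖ := norm_sum_le _ _
      _ ≤ ∑ j : Fin k → Fin n, if ¬ Function.Injective j then (2 : ℝ) else 0 := by
          refine Finset.sum_le_sum fun j _ => ?_
          split_ifs with hj
          · rw [hA]
            simp only
            rw [integral_piChar_pushFreq_eq hU s hj hj₀, sub_self, norm_zero]
          · have := norm_sub_le (A j) (A j₀)
            linarith [hAle j, hAle j₀]
      _ = 2 * (#{j : Fin k → Fin n | ¬ Function.Injective j} : ℝ) := by
          rw [← Finset.sum_filter, sum_const, nsmul_eq_mul, mul_comm]
  rw [h1, norm_mul, norm_pow, norm_inv, Complex.norm_natCast, inv_pow]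
  rw [inv_mul_le_iff₀ hnR]
  refine h5.trans (le_of_eq ?_)
  field_simp

lemma tendsto_descFactorial_div_pow (k : ℕ) :
    Tendsto (fun n : ℕ => (n.descFactorial k : ℝ) / (n : ℝ) ^ k) atTop (nhds 1) := by
  have h := isEquivalent_descFactorial k
  rw [Asymptotics.isEquivalent_iff_tendsto_one] at h
  · exact h
  · filter_upwards [eventually_ne_atTop 0] with n hn
    positivity

lemma tendsto_integral_piChar_orthantUnif {q : ℝ} (hq : 1 < q) {k : ℕ} (s : Fin k → ℝ)
    (h0 : ∀ n ≠ 0, orthantMeasure n {x | lorentzNorm q x ≤ (n : ℝ) ^ (1 / q)} ≠ 0)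
    (h1 : ∀ n ≠ 0, orthantMeasure n {x | lorentzNorm q x ≤ (n : ℝ) ^ (1 / q)} ≠ ⊤) :
    Tendsto (fun n : ℕ => ∫ x, piChar (pushFreq s (Fin.castAdd n)) x
        ∂orthantUnif q (((k + n : ℕ) : ℝ) ^ (1 / q)) (k + n))
      atTop (nhds (∏ l, profileChar q (s l))) := by
  have hprod : Tendsto (fun n : ℕ => ∏ l, ((n : ℂ)⁻¹ *
      stepSum (fun m => 1 / ((n : ℝ) / (n : ℝ) ^ (1 / q) * weightSum q (m + 1))) (s l) n))
      atTop (nhds (∏ l, profileChar q (s l))) :=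
    tendsto_finsetProd _ fun l _ => tendsto_stepSum hq (s l)
  have hb : Tendsto (fun n : ℕ =>
      9 * (∑ l, |s l|) ^ 2 *
        ∑ m ∈ range n, (1 / ((n : ℝ) / (n : ℝ) ^ (1 / q) * weightSum q (m + 1))) ^ 2
      + (∑ l, |s l|) * (2 / √(n : ℝ))
      + 2 * (1 - (n.descFactorial k : ℝ) / (n : ℝ) ^ k)) atTop (nhds 0) := by
    have e1 := (tendsto_sum_sq_recip hq).const_mul (9 * (∑ l, |s l|) ^ 2)
    have e2 : Tendsto (fun n : ℕ => (∑ l, |s l|) * (2 / √(n : ℝ))) atTop (nhds 0) := by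
      have : Tendsto (fun n : ℕ => (2 : ℝ) / √(n : ℝ)) atTop (nhds 0) :=
        tendsto_const_nhds.div_atTop
          (Real.tendsto_sqrt_atTop.comp tendsto_natCast_atTop_atTop)
      simpa using this.const_mul (∑ l, |s l|)
    have e3 := ((tendsto_descFactorial_div_pow k).const_sub 1).const_mul 2
    simpa using (e1.add e2).add e3
  have hshift : Tendsto (fun n : ℕ => k + n) atTop atTop :=
    tendsto_atTop_mono (fun n => Nat.le_add_left n k) tendsto_id
  refine (hprod.comp hshift).congr_dist ?_
  refine squeeze_zero' (Eventually.of_forall fun _ => dist_nonneg) ?_ (hb.comp hshift)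
  filter_upwards [eventually_ne_atTop 0] with n hn0
  have hn : k + n ≠ 0 := by omega
  simp only [Function.comp_apply]
  have hU := isProbabilityMeasure_orthantUnif (h0 (k + n) hn) (h1 (k + n) hn)
  have hr : ∀ m, 0 < ((k + n : ℕ) : ℝ) / ((k + n : ℕ) : ℝ) ^ (1 / q) * weightSum q (m + 1) := fun m => by
    have := weightSum_pos q m
    have : (0 : ℝ) < ((k + n : ℕ) : ℝ) := by exact_mod_cast Nat.pos_of_ne_zero hn
    positivity
  have b1 := norm_integral_avgChar_peeledMeasure_expMeasure_sub_le hn hr s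
  have b2 := norm_integral_avgChar_orthantUnif_sub_le hq hn (h0 (k + n) hn) (h1 (k + n) hn) s
  have b3 := norm_integral_avgChar_sub_piChar_le hn
    (measurePreserving_comp_perm_orthantUnif q (((k + n : ℕ) : ℝ) ^ (1 / q)) hq) s
    (Fin.castAdd_injective k n)
  rw [← dist_eq_norm] at b1 b2 b3
  rw [dist_comm] at b1
  refine (dist_triangle4 _ _ _ _).trans (add_le_add (add_le_add b1 b2) b3)

/-! ### Symmetrization -/

/-- The sign `±1` encoded by a Boolean. -/
def boolSign (b : Bool) : ℝ := if b then 1 else -1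

lemma map_boolSign_mul_restrict_Ioi_add (s : Set ℝ) (hs : MeasurableSet s) :
    ∑ b, ((volume : Measure ℝ).restrict (Set.Ioi 0)) ((fun x => boolSign b * x) ⁻¹' s)
      = volume s := by
  have hneg : MeasurableSet ((fun x : ℝ => -x) ⁻¹' s) := measurable_neg hs
  rw [Fintype.sum_bool]
  simp only [boolSign, if_true, Bool.false_eq_true, if_false, one_mul, neg_mul, Set.preimage_id']
  rw [Measure.restrict_apply hs, Measure.restrict_apply hneg]
  have h1 : volume ((fun x : ℝ => -x) ⁻¹' s ∩ Set.Ioi 0) = volume (s ∩ Set.Iio 0) := by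
    rw [← Measure.measure_preimage_neg volume (s ∩ Set.Iio 0)]
    congr 1
    ext x
    simp
  rw [h1, ← Measure.restrict_apply hs, ← Measure.restrict_apply hs,
    Measure.restrict_congr_set Ioi_ae_eq_Ici, add_comm, ← Measure.add_apply]
  have h2 : (volume : Measure ℝ).restrict (Set.Iio 0) + volume.restrict (Set.Ici 0) = volume := by
    have := Measure.restrict_add_restrict_compl (μ := (volume : Measure ℝ))
      (measurableSet_Iio (a := (0 : ℝ)))
    rwa [Set.compl_Iio] at this
  rw [h2]

lemma measurable_boolSign_mul {n : ℕ} (ε : Fin n → Bool) :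
    Measurable fun (x : Fin n → ℝ) i => boolSign (ε i) * x i := by fun_prop

lemma volume_eq_sum_map_orthantMeasure (n : ℕ) :
    (volume : Measure (Fin n → ℝ))
      = ∑ ε : Fin n → Bool,
        (orthantMeasure n).map fun x i => boolSign (ε i) * x i := by
  refine Measure.pi_eq fun s hs => ?_
  rw [Measure.finsetSum_apply]
  have h1 : ∀ ε : Fin n → Bool,
      (orthantMeasure n).map (fun x i => boolSign (ε i) * x i) (Set.univ.pi s)
        = ∏ i, ((volume : Measure ℝ).restrict (Set.Ioi 0))
          ((fun x => boolSign (ε i) * x) ⁻¹' s i) := by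
    intro ε
    rw [Measure.map_apply (measurable_boolSign_mul ε) (MeasurableSet.univ_pi hs),
      orthantMeasure, ← Measure.pi_pi]
    rfl
  simp_rw [h1]
  rw [← Fintype.piFinset_univ, ← Finset.prod_univ_sum
    (f := fun i b => ((volume : Measure ℝ).restrict (Set.Ioi 0))
          ((fun x => boolSign b * x) ⁻¹' s i))]
  exact Finset.prod_congr rfl fun i _ => map_boolSign_mul_restrict_Ioi_add _ (hs i)

lemma lorentzNorm_boolSign_mul (q : ℝ) {n : ℕ} (ε : Fin n → Bool) (x : Fin n → ℝ) :
    lorentzNorm q (fun i => boolSign (ε i) * x i) = lorentzNorm q x := by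
  refine lorentzNorm_congr_abs q fun i => ?_
  rw [abs_mul]
  cases ε i <;> simp [boolSign]

lemma volume_restrict_lorentzNorm_le {q : ℝ} (hq : 1 < q) (R : ℝ) (n : ℕ) :
    (volume : Measure (Fin n → ℝ)).restrict {x | lorentzNorm q x ≤ R}
      = ∑ ε : Fin n → Bool, ((orthantMeasure n).restrict {x | lorentzNorm q x ≤ R}).map
        fun x i => boolSign (ε i) * x i := by
  have hB := measurableSet_lorentzNorm_le hq R n
  ext s hs
  rw [Measure.restrict_apply hs, volume_eq_sum_map_orthantMeasure, Measure.finsetSum_apply,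
    Measure.finsetSum_apply]
  refine Finset.sum_congr rfl fun ε _ => ?_
  have hm := measurable_boolSign_mul ε
  rw [Measure.map_apply hm (hs.inter hB), Measure.map_apply hm hs,
    Measure.restrict_apply (hm hs), Set.preimage_inter]
  congr 2
  ext x
  simp only [Set.mem_preimage, Set.mem_ofPred_eq, lorentzNorm_boolSign_mul]

lemma volume_lorentzNorm_le {q : ℝ} (hq : 1 < q) (R : ℝ) (n : ℕ) :
    (volume : Measure (Fin n → ℝ)) {x | lorentzNorm q x ≤ R}
      = 2 ^ n * orthantMeasure n {x | lorentzNorm q x ≤ R} := by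
  rw [← Measure.restrict_apply_univ, volume_restrict_lorentzNorm_le hq, Measure.finsetSum_apply]
  have : ∀ ε : Fin n → Bool, ((orthantMeasure n).restrict {x | lorentzNorm q x ≤ R}).map
        (fun x i => boolSign (ε i) * x i) Set.univ
      = orthantMeasure n {x | lorentzNorm q x ≤ R} := fun ε => by
    rw [Measure.map_apply (measurable_boolSign_mul ε) MeasurableSet.univ, Set.preimage_univ,
      Measure.restrict_apply_univ]
  simp [this]

lemma unifOn_lorentzNorm_le {q : ℝ} (hq : 1 < q) (R : ℝ) (n : ℕ) :
    unifOn {x : Fin n → ℝ | lorentzNorm q x ≤ R}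
      = ((2 : ℝ≥0∞) ^ n)⁻¹ • ∑ ε : Fin n → Bool,
        (orthantUnif q R n).map fun x i => boolSign (ε i) * x i := by
  rw [unifOn, volume_lorentzNorm_le hq, volume_restrict_lorentzNorm_le hq]
  simp_rw [orthantUnif, Measure.map_smul]
  rw [← Finset.smul_sum, smul_smul, ENNReal.mul_inv]
  · simp
  · simp

lemma integral_piChar_unifOn {q : ℝ} (hq : 1 < q) (R : ℝ) {n : ℕ}
    (h0 : orthantMeasure n {x | lorentzNorm q x ≤ R} ≠ 0)
    (h1 : orthantMeasure n {x | lorentzNorm q x ≤ R} ≠ ⊤) (t : Fin n → ℝ) :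
    ∫ x, piChar t x ∂unifOn {x : Fin n → ℝ | lorentzNorm q x ≤ R}
      = ((2 : ℂ) ^ n)⁻¹ * ∑ ε : Fin n → Bool,
        ∫ x, piChar (fun i => boolSign (ε i) * t i) x ∂orthantUnif q R n := by
  have hU := isProbabilityMeasure_orthantUnif h0 h1
  have hm := fun ε : Fin n → Bool => measurable_boolSign_mul ε
  have hP : ∀ ε : Fin n → Bool, IsProbabilityMeasure
      ((orthantUnif q R n).map fun x i => boolSign (ε i) * x i) := fun ε =>
    Measure.isProbabilityMeasure_map (hm ε).aemeasurable
  rw [unifOn_lorentzNorm_le hq, integral_smul_measure,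
    integral_finsetSum_measure fun ε _ => integrable_piChar _ t]
  rw [ENNReal.toReal_inv, ENNReal.toReal_pow, ENNReal.toReal_ofNat, Complex.real_smul]
  push_cast
  congr 1
  refine Finset.sum_congr rfl fun ε _ => ?_
  rw [integral_map (hm ε).aemeasurable (continuous_piChar t).aestronglyMeasurable]
  refine integral_congr_ae (ae_of_all _ fun x => ?_)
  simp only [piChar]
  congr 4
  ext i
  ring

lemma sum_comp_castAdd {k n : ℕ} (F : (Fin k → Bool) → ℂ) :
    ((2 : ℂ) ^ (k + n))⁻¹ * ∑ ε : Fin (k + n) → Bool, F (fun l => ε (Fin.castAdd n l))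
      = ((2 : ℂ) ^ k)⁻¹ * ∑ δ, F δ := by
  rw [← (Fin.appendEquiv k n).sum_comp, Fintype.sum_prod_type]
  have : ∀ (x : Fin k → Bool) (y : Fin n → Bool),
      F (fun l => Fin.appendEquiv k n (x, y) (Fin.castAdd n l)) = F x := by
    intro x y
    congr 1
    ext l
    simp [Fin.appendEquiv]
  simp_rw [this]
  simp only [sum_const, card_univ, Fintype.card_fun, Fintype.card_fin, Fintype.card_bool,
    nsmul_eq_mul, ← Finset.mul_sum]
  push_cast
  rw [pow_add]
  field_simp

lemma tendsto_integral_piChar_unifOn {q : ℝ} (hq : 1 < q) {k : ℕ} (s : Fin k → ℝ)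
    (h0 : ∀ n ≠ 0, orthantMeasure n {x | lorentzNorm q x ≤ (n : ℝ) ^ (1 / q)} ≠ 0)
    (h1 : ∀ n ≠ 0, orthantMeasure n {x | lorentzNorm q x ≤ (n : ℝ) ^ (1 / q)} ≠ ⊤) :
    Tendsto (fun n : ℕ => ∫ x, piChar (pushFreq s (Fin.castAdd n)) x
        ∂unifOn {x : Fin (k + n) → ℝ | lorentzNorm q x ≤ ((k + n : ℕ) : ℝ) ^ (1 / q)})
      atTop (nhds (∏ l, charFun (limitMeasure q) (s l))) := by
  have hlim : ∏ l, charFun (limitMeasure q) (s l)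
      = ((2 : ℂ) ^ k)⁻¹ * ∑ δ : Fin k → Bool, ∏ l, profileChar q (boolSign (δ l) * s l) := by
    rw [← Fintype.piFinset_univ, ← Finset.prod_univ_sum
      (f := fun l b => profileChar q (boolSign b * s l))]
    have : ((2 : ℂ) ^ k)⁻¹ = ∏ _l : Fin k, (2 : ℂ)⁻¹ := by simp
    rw [this, ← Finset.prod_mul_distrib]
    refine Finset.prod_congr rfl fun l _ => ?_
    rw [charFun_limitMeasure hq, Fintype.sum_bool]
    simp only [boolSign, if_true, Bool.false_eq_true, if_false, one_mul, neg_mul]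
    ring
  rw [hlim]
  have hsum := (tendsto_finsetSum univ fun (δ : Fin k → Bool) _ =>
    tendsto_integral_piChar_orthantUnif hq (fun l => boolSign (δ l) * s l) h0 h1).const_mul
      ((2 : ℂ) ^ k)⁻¹
  refine hsum.congr' ?_
  filter_upwards [eventually_ne_atTop 0] with n hn0
  have hn : k + n ≠ 0 := by omega
  rw [integral_piChar_unifOn hq _ (h0 _ hn) (h1 _ hn), ← sum_comp_castAdd (n := n)]
  congr 1
  refine Finset.sum_congr rfl fun ε _ => integral_congr_ae (ae_of_all _ fun x => ?_)
  simp only [piChar, sum_pushFreq_mul]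
  have h2 : ∑ i, boolSign (ε i) * pushFreq s (Fin.castAdd n) i * x i
      = ∑ i, pushFreq s (Fin.castAdd n) i * (boolSign (ε i) * x i) :=
    Finset.sum_congr rfl fun i _ => by ring
  rw [h2, sum_pushFreq_mul]
  congr 4
  ext l
  ring

/-! ### The limit theorem -/

lemma scaledLorentzBall_eq {q : ℝ} {n : ℕ} (hn : n ≠ 0) :
    scaledLorentzBall q n = {x | lorentzNorm q x ≤ (n : ℝ) ^ (1 / q)} := by
  have hR : (0 : ℝ) < (n : ℝ) ^ (1 / q) := by positivity
  ext x
  simp only [scaledLorentzBall, lorentzBall, Set.mem_image, Set.mem_ofPred_eq]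
  constructor
  · rintro ⟨y, hy, rfl⟩
    rw [lorentzNorm_smul q hR.le]
    exact mul_le_of_le_one_right hR.le hy
  · intro hx
    refine ⟨((n : ℝ) ^ (1 / q))⁻¹ • x, ?_, smul_inv_smul₀ hR.ne' x⟩
    rw [lorentzNorm_smul q (inv_nonneg.mpr hR.le)]
    exact (inv_mul_le_one₀ hR).mpr hx

lemma orthantMeasure_ne_of_isProbabilityMeasure_unifOn {q : ℝ} (hq : 1 < q) {R : ℝ} {n : ℕ}
    (h : IsProbabilityMeasure (unifOn {x : Fin n → ℝ | lorentzNorm q x ≤ R})) :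
    orthantMeasure n {x | lorentzNorm q x ≤ R} ≠ 0
      ∧ orthantMeasure n {x | lorentzNorm q x ≤ R} ≠ ⊤ := by
  have h1 := h.measure_univ
  rw [unifOn, Measure.smul_apply, Measure.restrict_apply_univ, volume_lorentzNorm_le hq,
    smul_eq_mul] at h1
  constructor <;> intro h2 <;> rw [h2] at h1 <;> simp at h1

/-- Weak Poincaré–Maxwell–Borel principle: for `X̃^{(n)}` uniform on `D̃_{q,1}^n`,
the first `k` coordinates converge in distribution to `ν_{q,1}^{⊗k}`. -/
theorem poincare_maxwell_borel_lorentzBall (q : ℝ) (hq : 1 < q) (k : ℕ)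
    {Ω : Type*} [MeasurableSpace Ω] (P : Measure Ω) [IsProbabilityMeasure P]
    (X : (n : ℕ) → Ω → Fin n → ℝ) (hXmeas : ∀ n, Measurable (X n))
    (hX : ∀ n, Measure.map (X n) P = unifOn (scaledLorentzBall q n))
    (f : (Fin k → ℝ) → ℝ) (hf : Continuous f) (hfb : ∃ C, ∀ y, |f y| ≤ C) :
    Tendsto (fun n : ℕ =>
        ∫ ω, f (fun i : Fin k => X (k + n) ω (Fin.castLE (Nat.le_add_right k n) i)) ∂P)
      atTop (nhds (∫ y, f y ∂(Measure.pi fun _ : Fin k => limitMeasure q))) := by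
  have hUnif : ∀ n : ℕ, n ≠ 0 →
      Measure.map (X n) P = unifOn {x : Fin n → ℝ | lorentzNorm q x ≤ (n : ℝ) ^ (1 / q)} :=
    fun n hn => by rw [hX n, scaledLorentzBall_eq hn]
  have hne := fun (n : ℕ) (hn : n ≠ 0) =>
    orthantMeasure_ne_of_isProbabilityMeasure_unifOn hq
      ((hUnif n hn) ▸ Measure.isProbabilityMeasure_map (μ := P) (hXmeas n).aemeasurable)
  have hν := isProbabilityMeasure_limitMeasure hq
  set Y : ℕ → Ω → EuclideanSpace ℝ (Fin k) := fun n ω =>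
    WithLp.toLp 2 fun i : Fin k => X (k + n) ω (Fin.castLE (Nat.le_add_right k n) i) with hY
  have hYm : ∀ n, Measurable (Y n) := fun n => by
    refine (PiLp.continuous_toLp 2 _).measurable.comp (measurable_pi_lambda _ fun i => ?_)
    exact (measurable_pi_apply _).comp (hXmeas _)
  have hTm : Measurable (WithLp.toLp 2 : (Fin k → ℝ) → EuclideanSpace ℝ (Fin k)) :=
    (PiLp.continuous_toLp 2 _).measurable
  let law : ℕ → ProbabilityMeasure (EuclideanSpace ℝ (Fin k)) := fun n =>
    ⟨P.map (Y n), Measure.isProbabilityMeasure_map (hYm n).aemeasurable⟩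
  let lim : ProbabilityMeasure (EuclideanSpace ℝ (Fin k)) :=
    ⟨(Measure.pi fun _ : Fin k => limitMeasure q).map (WithLp.toLp 2),
      Measure.isProbabilityMeasure_map hTm.aemeasurable⟩
  have hlaw : Tendsto law atTop (nhds lim) := by
    refine ProbabilityMeasure.tendsto_of_tendsto_charFun fun t => ?_
    have hlim : charFun (lim : Measure (EuclideanSpace ℝ (Fin k))) t
        = ∏ l, charFun (limitMeasure q) (t l) := charFun_pi t
    rw [hlim]
    refine (tendsto_integral_piChar_unifOn hq (fun l => t l) (fun n hn => (hne n hn).1)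
      (fun n hn => (hne n hn).2)).congr' ?_
    filter_upwards [eventually_ne_atTop 0] with n hn0
    rw [← hUnif (k + n) (by omega), integral_map (hXmeas _).aemeasurable
      (continuous_piChar _).aestronglyMeasurable]
    change _ = charFun (P.map (Y n)) t
    rw [charFun_apply, integral_map (hYm n).aemeasurable (by fun_prop)]
    refine integral_congr_ae (ae_of_all _ fun ω => ?_)
    simp only [piChar, sum_pushFreq_mul]
    congr 3
  obtain ⟨C, hC⟩ := hfb
  have hfT : Continuous fun y : EuclideanSpace ℝ (Fin k) => f (WithLp.ofLp y) :=
    hf.comp (PiLp.continuous_ofLp 2 _)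
  have h := (ProbabilityMeasure.tendsto_iff_forall_integral_tendsto.mp hlaw)
    (BoundedContinuousFunction.ofNormedAddCommGroup _ hfT C fun y => hC _)
  have h1 : ∀ n, ∫ y, f (WithLp.ofLp y) ∂(P.map (Y n))
      = ∫ ω, f (fun i : Fin k => X (k + n) ω (Fin.castLE (Nat.le_add_right k n) i)) ∂P :=
    fun n => integral_map (hYm n).aemeasurable hfT.aestronglyMeasurable
  have h2 : ∫ y, f (WithLp.ofLp y)
        ∂((Measure.pi fun _ : Fin k => limitMeasure q).map (WithLp.toLp 2))
      = ∫ y, f y ∂(Measure.pi fun _ : Fin k => limitMeasure q) :=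
    integral_map hTm.aemeasurable hfT.aestronglyMeasurable
  rw [← h2]
  exact h.congr h1

end
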